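/- Let K be a field of characteristic zero and let d ≤ D and n be positive integers. For α = (α_2, ..., α_n) ∈ K^{n−1}, define g_{α,1} = x_1^d + (x_2+1)^d + ⋯ + (x_n+1)^d, g_{α,i} = α_i x_i^D (2 ≤ i ≤ n), and p_{α,i} := x_1^{(i)} − 𝓛_{g_α}^{i−1}(g_{α,1}) for 1 ≤ i ≤ n. Set N_0 := Π_{k=1}^{n} (d + (k−1)(D−1)) and N_ℓ := N_0 / (d + (ℓ−1)(D−1)) for 1 ≤ ℓ ≤ n. Then there exists a nonempty Zariski open subset U ⊂ K^{n−1} such that for every α ∈ U and every 0 ≤ ℓ ≤ n, the system p_{α,1} = ⋯ = p_{α,n} = 0, regarded as a polynomial system in the unknowns x_1^{(ℓ)}, x_2, ..., x_n over the field F_ℓ := K(x_1, ..., x_1^{(ℓ−1)}, x_1^{(ℓ+1)}, ..., x_1^{(n)}), has exactly N_ℓ distinct solutions in the algebraic closure of F_ℓ. -/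

import Mathlib

open MvPolynomial

noncomputable section

/-- The right-hand side of the system `(3)`:
`g_1 = x_1^d + (x_2+1)^d + ⋯ + (x_n+1)^d`, `g_i = α_i x_i^D` for `i ≠ 1`. -/
def gsys (K : Type*) [CommRing K] (n d D : ℕ) [NeZero n]
    (α : {i : Fin n // i ≠ 0} → K) : Fin n → MvPolynomial (Fin n) K := fun i =>
  if h : i = 0 then
    X 0 ^ d + ∑ j ∈ Finset.univ.filter (fun j : Fin n => j ≠ 0), (X j + 1) ^ d
  else C (α ⟨i, h⟩) * X i ^ D

/-- The Lie derivative `𝓛_g = Σ_{i=1}^n g_i ∂/∂x_i` on `K[x_1, …, x_n]`. -/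
def lieD {K : Type*} [CommRing K] {n : ℕ} (g : Fin n → MvPolynomial (Fin n) K) :
    Derivation K (MvPolynomial (Fin n) K) (MvPolynomial (Fin n) K) :=
  MvPolynomial.mkDerivation K g

/-- The polynomials `p_{α,i} = x_1^{(i)} - 𝓛_{g_α}^{i-1}(g_{α,1})`, `1 ≤ i ≤ n`
(indexed here by `j : Fin n` with `i = j + 1`). -/
def pSys (K : Type*) [CommRing K] (n d D : ℕ) [NeZero n]
    (α : {i : Fin n // i ≠ 0} → K) :
    Fin n → MvPolynomial (Fin (n + 1) ⊕ {i : Fin n // i ≠ 0}) K := fun j =>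
  X (Sum.inl j.succ) -
    rename (fun i : Fin n => if h : i = 0 then Sum.inl 0 else Sum.inr ⟨i, h⟩)
      ((⇑(lieD (gsys K n d D α)))^[(j : ℕ)] (gsys K n d D α 0))

/-- The field `F_ℓ = K(x_1, …, x_1^{(ℓ-1)}, x_1^{(ℓ+1)}, …, x_1^{(n)})`. -/
abbrev Ffield (K : Type*) [Field K] (n : ℕ) (ℓ : Fin (n + 1)) : Type _ :=
  FractionRing (MvPolynomial {i : Fin (n + 1) // i ≠ ℓ} K)

section Rank

open Module

theorem exists_finrank_mul_le {K A B : Type*} [Field K] [CommRing A] [IsDomain A] [CommRing B]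
    [Algebra K A] [Algebra K B] [Algebra A B] [IsScalarTower K A B] (W : ℕ → Submodule K A)
    (V : ℕ → Submodule K B)
    [∀ N, FiniteDimensional K (W N)] [∀ N, FiniteDimensional K (V N)]
    (hV : Monotone V) (hVex : ∀ b, ∃ N, b ∈ V N)
    (hVmul : ∀ i j, ∀ a ∈ V i, ∀ b ∈ V j, a * b ∈ V (i + j))
    (hWV : ∀ i, ∀ a ∈ W i, algebraMap A B a ∈ V i) :
    ∃ C, ∀ N, finrank A B * finrank K (W N) ≤ finrank K (V (N + C)) := by
  obtain ⟨e, he⟩ := exists_linearIndependent_of_le_finrank (R := A) (M := B) le_rfl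
  choose deg hdeg using hVex
  refine ⟨∑ i, deg (e i), fun N => ?_⟩
  set C := ∑ i, deg (e i)
  have heC : ∀ i, e i ∈ V C := fun i =>
    hV (Finset.single_le_sum (f := fun i => deg (e i)) (fun _ _ => Nat.zero_le _)
      (Finset.mem_univ i)) (hdeg (e i))
  let T : (Fin (finrank A B) → W N) →ₗ[K] V (N + C) :=
    LinearMap.codRestrict _
      (∑ i, ((LinearMap.toSpanSingleton A B (e i)).restrictScalars K) ∘ₗ (W N).subtype ∘ₗ
        LinearMap.proj i) (fun c => by
          simp only [LinearMap.sum_apply, LinearMap.comp_apply]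
          refine Submodule.sum_mem _ fun i _ => ?_
          simp only [LinearMap.proj_apply, Submodule.subtype_apply,
            LinearMap.coe_restrictScalars, LinearMap.toSpanSingleton_apply, Algebra.smul_def]
          exact hVmul _ _ _ (hWV _ _ (c i).2) _ (heC i))
  have hT : Function.Injective T := by
    rw [← LinearMap.ker_eq_bot, LinearMap.ker_eq_bot']
    intro c hc
    have h0 : ∑ i, (c i : A) • e i = 0 := by
      have := congrArg (Subtype.val) hc
      simpa [T] using this
    have := Fintype.linearIndependent_iff.mp he (fun i => (c i : A)) h0
    ext i
    simpa using this i
  simpa only [finrank_pi_fintype, Finset.sum_const, Finset.card_univ, Fintype.card_fin,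
    smul_eq_mul] using LinearMap.finrank_le_finrank_of_injective hT

variable {K A B : Type*} [Field K] [CommRing A] [IsDomain A] [CommRing B] [IsDomain B]
  [Algebra K A] [Algebra K B] [Algebra A B] [IsScalarTower K A B] [FaithfulSMul A B]

theorem exists_finrank_le_mul [Module.Finite A B] (W : ℕ → Submodule K A) (V : ℕ → Submodule K B)
    [∀ N, FiniteDimensional K (W N)] [∀ N, FiniteDimensional K (V N)]
    (hW : Monotone W) (hWex : ∀ b, ∃ N, b ∈ W N)
    (hWmul : ∀ i j, ∀ a ∈ W i, ∀ b ∈ W j, a * b ∈ W (i + j)) (c : ℕ)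
    (hgen : ∀ N, V N ≤ (W N).map (IsScalarTower.toAlgHom K A B).toLinearMap * V c) :
    ∃ C, ∀ N, finrank K (V N) ≤ finrank A B * finrank K (W (N + C)) := by
  obtain ⟨e, he⟩ := exists_linearIndependent_of_le_finrank (R := A) (M := B) le_rfl
  have htors : ∀ b : B, ∃ a : A, a ≠ 0 ∧ ∃ q : Fin (finrank A B) → A, a • b = ∑ i, q i • e i := by
    intro b
    have h1 := Submodule.finrank_quotient_add_finrank (Submodule.span A (Set.range e))
    rw [finrank_span_eq_card he, Fintype.card_fin] at h1
    have h2 : Module.rank A (B ⧸ Submodule.span A (Set.range e)) = 0 := by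
      have h3 : finrank A (B ⧸ Submodule.span A (Set.range e)) = 0 := by omega
      rw [← Module.finrank_eq_rank, h3, Nat.cast_zero]
    rw [rank_eq_zero_iff] at h2
    obtain ⟨a, ha, h⟩ := h2 (Submodule.Quotient.mk b)
    refine ⟨a, ha, ?_⟩
    rw [← Submodule.Quotient.mk_smul, Submodule.Quotient.mk_eq_zero,
      Submodule.mem_span_range_iff_exists_fun] at h
    obtain ⟨q, hq⟩ := h
    exact ⟨q, hq.symm⟩
  let u := Module.finBasis K (V c)
  choose a ha q hq using fun b : B => htors b
  choose deg hdeg using hWex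
  let a₀ : A := ∏ j, a (u j)
  have ha₀ : a₀ ≠ 0 := Finset.prod_ne_zero_iff.mpr fun j _ => ha _
  let r : Fin (finrank K (V c)) → Fin (finrank A B) → A := fun j i =>
    (∏ k ∈ Finset.univ.erase j, a (u k)) * q (u j) i
  have hr : ∀ j, a₀ • (u j : B) = ∑ i, r j i • e i := by
    intro j
    have : a₀ = (∏ k ∈ Finset.univ.erase j, a (u k)) * a (u j) :=
      (Finset.prod_erase_mul _ _ (Finset.mem_univ j)).symm
    rw [this, mul_smul, hq, Finset.smul_sum]
    exact Finset.sum_congr rfl fun i _ => by rw [smul_smul]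
  let C := ∑ j, ∑ i, deg (r j i)
  have hrC : ∀ j i, r j i ∈ W C := fun j i => by
    refine hW ?_ (hdeg (r j i))
    exact (Finset.single_le_sum (f := fun i => deg (r j i)) (fun _ _ => Nat.zero_le _)
      (Finset.mem_univ i)).trans (Finset.single_le_sum (f := fun j => ∑ i, deg (r j i))
      (fun _ _ => Nat.zero_le _) (Finset.mem_univ j))
  refine ⟨C, fun N => ?_⟩
  let T : (Fin (finrank A B) → W (N + C)) →ₗ[K] B :=
      (∑ i, ((LinearMap.toSpanSingleton A B (e i)).restrictScalars K) ∘ₗ (W (N + C)).subtype ∘ₗ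
        LinearMap.proj i)
  let M : B →ₗ[K] B := (LinearMap.lsmul A B a₀).restrictScalars K
  have hM : Function.Injective M := by
    intro x y hxy
    have h : algebraMap A B a₀ * x = algebraMap A B a₀ * y := by
      simpa [M, Algebra.smul_def] using hxy
    refine mul_left_cancel₀ ?_ h
    rwa [Ne, FaithfulSMul.algebraMap_eq_zero_iff]
  have hle : (V N).map M ≤ LinearMap.range T := by
    rw [Submodule.map_le_iff_le_comap]
    refine (hgen N).trans ?_
    rw [Submodule.mul_le]
    rintro _ ⟨w, hw, rfl⟩ n hn
    have hn' : n = ∑ j, (u.repr ⟨n, hn⟩ j) • (u j : B) := by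
      have := congrArg Subtype.val (u.sum_repr ⟨n, hn⟩)
      simpa only [Submodule.coe_sum, Submodule.coe_smul] using this.symm
    refine ⟨fun i => ⟨w * ∑ j, (u.repr ⟨n, hn⟩ j) • r j i, hWmul _ _ _ hw _
      (Submodule.sum_mem _ fun j _ => Submodule.smul_mem _ _ (hrC j i))⟩, ?_⟩
    have e1 : M (algebraMap A B w * n) = w • a₀ • n := by
      simp only [M, LinearMap.coe_restrictScalars, LinearMap.lsmul_apply]
      rw [← Algebra.smul_def, smul_comm]
    have e2 : a₀ • n = ∑ i, (∑ j, (u.repr ⟨n, hn⟩ j) • r j i) • e i := by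
      conv_lhs => rw [hn', Finset.smul_sum]
      simp_rw [smul_comm a₀, hr, Finset.sum_smul, Finset.smul_sum, smul_assoc]
      exact Finset.sum_comm
    change T _ = M (algebraMap A B w * n)
    rw [e1, e2]
    simp [T, Finset.smul_sum, mul_smul]
  calc finrank K (V N) = finrank K ((V N).map M) :=
        (Submodule.equivMapOfInjective M hM (V N)).finrank_eq
    _ ≤ finrank K (LinearMap.range T) := Submodule.finrank_mono hle
    _ ≤ finrank K (Fin (finrank A B) → W (N + C)) := LinearMap.finrank_range_le T
    _ = _ := by
      simp only [finrank_pi_fintype, Finset.sum_const, Finset.card_univ, Fintype.card_fin,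
        smul_eq_mul]

attribute [local instance] FractionRing.liftAlgebra in
theorem natCard_algHom_algebraicClosure [CharZero A] [Module.Finite A B] :
    Nat.card (B →ₐ[A] AlgebraicClosure (FractionRing A)) = finrank A B := by
  let Q := FractionRing A
  let E := FractionRing B
  let Ω := AlgebraicClosure Q
  have : CharZero Q := charZero_of_injective_algebraMap (IsFractionRing.injective A Q)
  have hfin : Module.finrank Q E = finrank A B := IsFractionRing.finrank_eq A Q B E
  have : FiniteDimensional Q E := .of_isLocalization A B (nonZeroDivisors A)
  have : Algebra.IsSeparable Q E := inferInstance
  rw [← hfin, ← AlgHom.natCard_of_splits Q E Ω (fun x => IsAlgClosed.splits _)]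
  have hAΩ : Function.Injective (algebraMap A Ω) := by
    rw [IsScalarTower.algebraMap_eq A Q Ω]
    exact (algebraMap Q Ω).injective.comp (IsFractionRing.injective A Q)
  have hinj : ∀ g : B →ₐ[A] Ω, Function.Injective g := by
    intro g
    rw [RingHom.injective_iff_ker_eq_bot]
    apply Ideal.eq_bot_of_comap_eq_bot (R := A)
    change Ideal.comap _ (RingHom.ker (g : B →+* Ω)) = ⊥
    rw [RingHom.comap_ker, AlgHom.comp_algebraMap, ← RingHom.injective_iff_ker_eq_bot]
    exact hAΩ
  symm
  refine Nat.card_congr (Equiv.ofBijective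
    (fun f : E →ₐ[Q] Ω => (f.restrictScalars A).comp (IsScalarTower.toAlgHom A B E)) ⟨?_, ?_⟩)
  · intro f g hfg
    have : (f : E →+* Ω) = g := by
      apply IsLocalization.ringHom_ext (nonZeroDivisors B)
      ext b
      exact DFunLike.congr_fun hfg b
    ext x
    exact DFunLike.congr_fun this x
  · intro g
    refine ⟨AlgHom.extendScalarsOfIsLocalization Q (nonZeroDivisors A)
      (IsFractionRing.liftAlgHom (K := E) (hinj g)), ?_⟩
    ext b
    simp

end Rank

section Counting

theorem le_of_forall_mul_le_mul_shift {f : ℕ → ℕ} {a b c n : ℕ} (h0 : 1 ≤ f 0)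
    (hf : ∀ N, f N ≤ (N + 1) ^ n) (h : ∀ N, a * f N ≤ b * f (N + c)) : a ≤ b := by
  by_contra! hab
  have key : ∀ k, a ^ k ≤ b ^ k * f (k * c) := by
    intro k
    induction k with
    | zero => simpa using h0
    | succ k ih =>
      calc a ^ (k + 1) = a * a ^ k := pow_succ' _ _
        _ ≤ a * (b ^ k * f (k * c)) := Nat.mul_le_mul_left _ ih
        _ = b ^ k * (a * f (k * c)) := by ring
        _ ≤ b ^ k * (b * f (k * c + c)) := Nat.mul_le_mul_left _ (h _)
        _ = b ^ (k + 1) * f ((k + 1) * c) := by rw [add_one_mul]; ring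
  have ha : (0 : ℝ) < a := by exact_mod_cast (Nat.zero_le b).trans_lt hab
  have hr : |(b / a : ℝ)| < 1 := by
    rw [abs_of_nonneg (by positivity), div_lt_one ha]
    exact_mod_cast hab
  have ht := (tendsto_pow_const_mul_const_pow_of_abs_lt_one n hr).const_mul (((c : ℝ) + 1) ^ n)
  rw [mul_zero] at ht
  obtain ⟨k, hk, hk1⟩ := ((ht.eventually (gt_mem_nhds one_pos)).and
    (Filter.eventually_ge_atTop 1)).exists
  have h1 : (a : ℝ) ^ k ≤ b ^ k * ((c + 1) ^ n * k ^ n) := by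
    have h2 : k * c + 1 ≤ (c + 1) * k := by nlinarith
    have := (key k).trans (Nat.mul_le_mul_left _ ((hf _).trans (Nat.pow_le_pow_left h2 n)))
    rw [mul_pow] at this
    exact_mod_cast this
  rw [div_pow, ← mul_assoc, ← mul_div_assoc, div_lt_one (by positivity)] at hk
  linarith [mul_comm ((b : ℝ) ^ k) ((c + 1) ^ n * k ^ n)]

/-- The number of exponent vectors of weight at most `N`. -/
def weightCount {ι : Type*} (w : ι → ℕ) (N : ℕ) : ℕ :=
  Nat.card {a : ι →₀ ℕ // Finsupp.weight w a ≤ N}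

variable {ι σ : Type*} [Fintype ι] [Fintype σ]

theorem finite_weight_le {w : ι → ℕ} (hw : ∀ i, 0 < w i) (N : ℕ) :
    Finite {a : ι →₀ ℕ // Finsupp.weight w a ≤ N} :=
  Finsupp.finite_of_nat_weight_le w (fun i => (hw i).ne') N

theorem weight_eq_sum (w : ι → ℕ) (a : ι →₀ ℕ) : Finsupp.weight w a = ∑ i, a i * w i := by
  rw [Finsupp.weight_apply, Finsupp.sum_fintype _ _ (by simp)]
  simp

theorem one_le_weightCount_one_zero : 1 ≤ weightCount (1 : ι → ℕ) 0 := by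
  have := finite_weight_le (w := (1 : ι → ℕ)) (by simp) 0
  have : Nonempty {a : ι →₀ ℕ // Finsupp.weight (1 : ι → ℕ) a ≤ 0} := ⟨⟨0, by simp⟩⟩
  exact Nat.card_pos

theorem weightCount_one_le (N : ℕ) : weightCount (1 : ι → ℕ) N ≤ (N + 1) ^ Fintype.card ι := by
  classical
  have : Nat.card (ι → Fin (N + 1)) = (N + 1) ^ Fintype.card ι := by simp
  rw [← this]
  have hb : ∀ (a : {a : ι →₀ ℕ // Finsupp.weight (1 : ι → ℕ) a ≤ N}) (i : ι),
      (a : ι →₀ ℕ) i < N + 1 := by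
    intro a i
    have h := a.2
    rw [weight_eq_sum] at h
    have := Finset.single_le_sum (f := fun i => (a : ι →₀ ℕ) i * (1 : ι → ℕ) i)
      (fun _ _ => Nat.zero_le _) (Finset.mem_univ i)
    simp only [Pi.one_apply, mul_one] at this h
    omega
  refine Nat.card_le_card_of_injective
    (fun (a : {a : ι →₀ ℕ // Finsupp.weight (1 : ι → ℕ) a ≤ N}) i => ⟨(a : ι →₀ ℕ) i, hb a i⟩) ?_
  intro a b hab
  ext i
  simpa using congrFun hab i

theorem weightCount_one_congr (e : ι ≃ σ) (N : ℕ) :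
    weightCount (1 : ι → ℕ) N = weightCount (1 : σ → ℕ) N := by
  refine Nat.card_congr ((Finsupp.domCongr (M := ℕ) e).toEquiv.subtypeEquiv fun a => ?_)
  rw [weight_eq_sum, weight_eq_sum]
  simp only [Pi.one_apply, mul_one]
  rw [← e.sum_comp]
  simp

theorem weightCount_one_le_prod_mul {w : ι → ℕ} (hw : ∀ i, 0 < w i) (N : ℕ) :
    weightCount (1 : ι → ℕ) N ≤ (∏ i, w i) * weightCount w N := by
  classical
  have := finite_weight_le hw N
  have hcard : Nat.card ((∀ i, Fin (w i)) × {a : ι →₀ ℕ // Finsupp.weight w a ≤ N}) =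
      (∏ i, w i) * weightCount w N := by
    rw [Nat.card_prod, Nat.card_pi]
    simp [weightCount]
  rw [← hcard]
  let q : (ι →₀ ℕ) → (ι →₀ ℕ) := fun b => Finsupp.equivFunOnFinite.symm fun i => b i / w i
  have hq : ∀ b : {b : ι →₀ ℕ // Finsupp.weight (1 : ι → ℕ) b ≤ N},
      Finsupp.weight w (q b) ≤ N := by
    intro b
    refine le_trans ?_ b.2
    rw [weight_eq_sum, weight_eq_sum]
    exact Finset.sum_le_sum fun i _ => by simpa [q] using Nat.div_mul_le_self _ _
  refine Nat.card_le_card_of_injective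
    (fun b => (fun i => ⟨(b : ι →₀ ℕ) i % w i, Nat.mod_lt _ (hw i)⟩, ⟨q b, hq b⟩)) ?_
  intro a b hab
  ext i
  simp only [Prod.mk.injEq, Subtype.mk.injEq] at hab
  have h1 := congrArg Fin.val (congrFun hab.1 i)
  have h2 : (a : ι →₀ ℕ) i / w i = (b : ι →₀ ℕ) i / w i := by
    simpa [q] using DFunLike.congr_fun hab.2 i
  simp only at h1
  rw [← Nat.div_add_mod ((a : ι →₀ ℕ) i) (w i), h1, h2, Nat.div_add_mod]

theorem prod_mul_weightCount_le (w : ι → ℕ) (N : ℕ) :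
    (∏ i, w i) * weightCount w N ≤ weightCount (1 : ι → ℕ) (N + ∑ i, w i) := by
  classical
  have := finite_weight_le (w := (1 : ι → ℕ)) (by simp) (N + ∑ i, w i)
  have hcard : Nat.card ((∀ i, Fin (w i)) × {a : ι →₀ ℕ // Finsupp.weight w a ≤ N}) =
      (∏ i, w i) * weightCount w N := by
    rw [Nat.card_prod, Nat.card_pi]
    simp [weightCount]
  rw [← hcard]
  let t : (∀ i, Fin (w i)) × {a : ι →₀ ℕ // Finsupp.weight w a ≤ N} → (ι →₀ ℕ) :=
    fun p => Finsupp.equivFunOnFinite.symm fun i => (p.2 : ι →₀ ℕ) i * w i + p.1 i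
  have ht : ∀ p, Finsupp.weight (1 : ι → ℕ) (t p) ≤ N + ∑ i, w i := by
    intro p
    have := p.2.2
    rw [weight_eq_sum] at this ⊢
    simp only [t, Finsupp.equivFunOnFinite_symm_apply_apply, Pi.one_apply, mul_one,
      Finset.sum_add_distrib]
    exact add_le_add this (Finset.sum_le_sum fun i _ => (p.1 i).2.le)
  refine Nat.card_le_card_of_injective (fun p => ⟨t p, ht p⟩) ?_
  rintro ⟨r, a⟩ ⟨s, b⟩ hab
  have h : ∀ i, (a : ι →₀ ℕ) i * w i + r i = (b : ι →₀ ℕ) i * w i + s i := fun i => by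
    simpa [t] using DFunLike.congr_fun (congrArg Subtype.val hab) i
  have hr : ∀ i, (r i : ℕ) = s i := fun i => by
    have := congrArg (· % w i) (h i)
    simpa [Nat.mod_eq_of_lt (r i).2, Nat.mod_eq_of_lt (s i).2] using this
  refine Prod.ext (funext fun i => Fin.ext (hr i)) ?_
  ext i
  have := h i
  rw [hr i, add_left_inj] at this
  exact Nat.eq_of_mul_eq_mul_right ((Nat.zero_le _).trans_lt (r i).2) this

end Counting

section Filtration

variable (K : Type*) [Field K] {ι : Type*}

/-- Polynomials all of whose monomials have weight at most `N`. -/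
def weightLE (w : ι → ℕ) (N : ℕ) : Submodule K (MvPolynomial ι K) :=
  restrictSupport K {a | Finsupp.weight w a ≤ N}

variable {K}

theorem weightLE_mono (w : ι → ℕ) : Monotone (weightLE K w) := fun _ _ h =>
  restrictSupport_mono K fun _ ha => le_trans ha h

theorem mul_mem_weightLE {w : ι → ℕ} {i j : ℕ} {a b : MvPolynomial ι K} (ha : a ∈ weightLE K w i)
    (hb : b ∈ weightLE K w j) : a * b ∈ weightLE K w (i + j) := by
  have h := Submodule.mul_mem_mul ha hb
  rw [weightLE, weightLE, ← restrictSupport_add] at h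
  refine restrictSupport_mono K ?_ h
  rintro _ ⟨x, hx, y, hy, rfl⟩
  change Finsupp.weight w (x + y) ≤ i + j
  rw [map_add]
  exact add_le_add hx hy

theorem exists_mem_weightLE (w : ι → ℕ) (a : MvPolynomial ι K) : ∃ N, a ∈ weightLE K w N :=
  ⟨a.support.sup (Finsupp.weight w), fun _ hx => Finset.le_sup (f := Finsupp.weight w) hx⟩

theorem mem_weightLE_one {N : ℕ} {a : MvPolynomial ι K} :
    a ∈ weightLE K 1 N ↔ a.totalDegree ≤ N := by
  rw [totalDegree, Finset.sup_le_iff]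
  have : ∀ x : ι →₀ ℕ, Finsupp.weight (1 : ι → ℕ) x = x.sum fun _ e => e := by
    intro x
    rw [Finsupp.weight_apply]
    simp
  simp only [← this]
  rfl

theorem X_mem_weightLE (w : ι → ℕ) (i : ι) : (X i : MvPolynomial ι K) ∈ weightLE K w (w i) := by
  refine monomial_mem_restrictSupport K |>.mpr (.inl ?_)
  simp [Finsupp.weight_single]

theorem finrank_weightLE (w : ι → ℕ) (N : ℕ) :
    Module.finrank K (weightLE K w N) = weightCount w N :=
  Module.finrank_eq_nat_card_basis (basisRestrictSupport K {a | Finsupp.weight w a ≤ N})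

theorem finiteDimensional_weightLE [Fintype ι] {w : ι → ℕ} (hw : ∀ i, 0 < w i) (N : ℕ) :
    FiniteDimensional K (weightLE K w N) :=
  have : Finite {a : ι →₀ ℕ | Finsupp.weight w a ≤ N} := finite_weight_le hw N
  Module.Finite.of_basis (basisRestrictSupport K {a | Finsupp.weight w a ≤ N})

end Filtration

section Generation

theorem homogeneousComponent_mul_of_le {R σ : Type*} [CommRing R] {h : MvPolynomial σ R} {w : ℕ}
    (hh : h.IsHomogeneous w) (q : MvPolynomial σ R) (N : ℕ) :
    homogeneousComponent N (q * h) =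
      if w ≤ N then homogeneousComponent (N - w) q * h else 0 := by
  conv_lhs => rw [← sum_homogeneousComponent q, Finset.sum_mul, map_sum]
  have h1 : ∀ k, homogeneousComponent N (homogeneousComponent k q * h) =
      if N = k + w then homogeneousComponent k q * h else 0 := fun k =>
    homogeneousComponent_of_mem ((homogeneousComponent_isHomogeneous k q).mul hh)
  simp only [h1]
  split_ifs with hN
  · by_cases hk : N - w < q.totalDegree + 1
    · rw [Finset.sum_eq_single (N - w), if_pos (by omega)]
      · intro b _ hb
        rw [if_neg (by omega)]
      · intro hb
        exact absurd (Finset.mem_range.mpr hk) hb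
    · rw [homogeneousComponent_eq_zero _ _ (by omega), zero_mul]
      refine Finset.sum_eq_zero fun k hk => ?_
      rw [if_neg]
      have := Finset.mem_range.mp hk
      omega
  · exact Finset.sum_eq_zero fun k _ => if_neg (by omega)

variable {K : Type*} [Field K] {ι σ : Type*} [Fintype ι] [Fintype σ]

theorem weightLE_one_le_map_mul {f h : ι → MvPolynomial σ K} {w : ι → ℕ}
    (hh : ∀ i, (h i).IsHomogeneous (w i)) (hf : ∀ i, (f i - h i).totalDegree < w i) {M : ℕ}
    (hM : ∀ j, X j ^ M ∈ Ideal.span (Set.range h)) (N : ℕ) :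
    weightLE K (1 : σ → ℕ) N ≤ (weightLE K w N).map (aeval (R := K) f).toLinearMap *
      weightLE K 1 (Fintype.card σ * M) := by
  induction N using Nat.strong_induction_on with | _ N ih =>
  set c := Fintype.card σ * M
  have hmono : ∀ {i j : ℕ}, i ≤ j → (weightLE K w i).map (aeval (R := K) f).toLinearMap *
      weightLE K 1 c ≤ (weightLE K w j).map (aeval (R := K) f).toLinearMap * weightLE K 1 c :=
    fun hij => mul_le_mul_left (Submodule.map_mono (weightLE_mono w hij)) _
  have hf1 : ∀ i {j : ℕ} {a}, a ∈ (weightLE K w j).map (aeval (R := K) f).toLinearMap *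
      weightLE K 1 c → a * f i ∈ (weightLE K w (j + w i)).map (aeval (R := K) f).toLinearMap *
        weightLE K 1 c := by
    intro i j a ha
    refine Submodule.mul_induction_on ha ?_ ?_
    · rintro _ ⟨u, hu, rfl⟩ b hb
      have : (aeval (R := K) f).toLinearMap u * b * f i =
          (aeval (R := K) f).toLinearMap (u * X i) * b := by simp; ring
      rw [this]
      exact Submodule.mul_mem_mul
        (Submodule.mem_map_of_mem (mul_mem_weightLE hu (X_mem_weightLE w i))) hb
    · intro x y hx hy
      rw [add_mul]
      exact add_mem hx hy
  intro p hp
  rw [p.as_sum]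
  refine Submodule.sum_mem _ fun m hm => ?_
  have hdeg : Finsupp.weight (1 : σ → ℕ) m = m.degree := by
    rw [Finsupp.degree_eq_weight_one]
    rfl
  have hmN : m.degree ≤ N := hdeg ▸ hp hm
  set a := coeff m p
  by_cases hmc : m.degree ≤ c
  · rw [← one_mul (monomial m a), ← map_one (aeval (R := K) f)]
    refine Submodule.mul_mem_mul (Submodule.mem_map_of_mem
      (f := (aeval (R := K) f).toLinearMap) ?_) ?_
    · refine (monomial_mem_restrictSupport K).mpr (.inl ?_)
      simp
    · refine (monomial_mem_restrictSupport K).mpr (.inl ?_)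
      exact hdeg.trans_le hmc
  obtain ⟨j, hj⟩ : ∃ j, M ≤ m j := by
    by_contra! hlt
    refine hmc ?_
    rw [Finsupp.degree_eq_sum]
    refine (Finset.sum_le_card_nsmul _ _ M fun i _ => (hlt i).le).trans ?_
    simp [c]
  have hmem : monomial m a ∈ Ideal.span (Set.range h) := by
    have : monomial m a = monomial (m - Finsupp.single j M) a * X j ^ M := by
      rw [X_pow_eq_monomial, monomial_mul, mul_one, tsub_add_cancel_of_le]
      simpa using hj
    rw [this]
    exact Ideal.mul_mem_left _ _ (hM j)
  obtain ⟨q, hq⟩ := Ideal.mem_span_range_iff_exists_fun.mp hmem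
  have hq2 := congrArg (homogeneousComponent m.degree) hq
  rw [homogeneousComponent_of_mem (isHomogeneous_monomial a rfl), if_pos rfl, map_sum] at hq2
  rw [← hq2]
  refine Submodule.sum_mem _ fun i _ => ?_
  rw [homogeneousComponent_mul_of_le (hh i)]
  split_ifs with hwi
  swap
  · exact zero_mem _
  have hw0 := (Nat.zero_le _).trans_lt (hf i)
  set r := homogeneousComponent (m.degree - w i) (q i)
  have hr : r.totalDegree ≤ m.degree - w i :=
    (homogeneousComponent_isHomogeneous _ _).totalDegree_le
  rw [← sub_sub_cancel (f i) (h i), mul_sub]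
  refine sub_mem ?_ ?_
  · have := hf1 i (ih (m.degree - w i) (by omega) (mem_weightLE_one.mpr hr))
    exact hmono (by omega) this
  · have h2 : (r * (f i - h i)).totalDegree ≤ m.degree - 1 := by
      refine (totalDegree_mul _ _).trans ?_
      have := hf i
      omega
    exact hmono (by omega) (ih (m.degree - 1) (by omega) (mem_weightLE_one.mpr h2))

end Generation

section Bezout

variable {K : Type*} [Field K] {ι σ : Type*} [Fintype ι] [Fintype σ]

theorem finite_toAlgebra_aeval {f h : ι → MvPolynomial σ K} {w : ι → ℕ}
    (hh : ∀ i, (h i).IsHomogeneous (w i)) (hf : ∀ i, (f i - h i).totalDegree < w i) {M : ℕ}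
    (hM : ∀ j, X j ^ M ∈ Ideal.span (Set.range h)) :
    letI := (aeval (R := K) f).toRingHom.toAlgebra
    Module.Finite (MvPolynomial ι K) (MvPolynomial σ K) := by
  let := (aeval (R := K) f).toRingHom.toAlgebra
  have hfd : FiniteDimensional K (weightLE K (1 : σ → ℕ) (Fintype.card σ * M)) :=
    finiteDimensional_weightLE (by simp) _
  obtain ⟨s, hs⟩ := (Submodule.fg_iff_finiteDimensional _).mpr hfd
  refine ⟨⟨s, ?_⟩⟩
  rw [eq_top_iff]
  intro b _
  obtain ⟨N, hN⟩ := exists_mem_weightLE (1 : σ → ℕ) b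
  refine Submodule.mul_induction_on (weightLE_one_le_map_mul hh hf hM N hN) ?_ ?_
  · rintro _ ⟨u, -, rfl⟩ v hv
    refine Submodule.smul_mem _ u (?_ : v ∈ _)
    rw [← hs] at hv
    refine Submodule.span_induction (fun x hx => Submodule.subset_span hx) (zero_mem _)
      (fun x y _ _ => add_mem) (fun a x _ hx => ?_) hv
    have : a • x = (C a : MvPolynomial ι K) • x := by
      rw [Algebra.smul_def, Algebra.smul_def]
      change _ = aeval f (C a) * x
      rw [aeval_C]
    rw [this]
    exact Submodule.smul_mem _ _ hx
  · exact fun x y hx hy => add_mem hx hy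

theorem aeval_injective_of_finite {f : ι → MvPolynomial σ K} (e : ι ≃ σ)
    (hfin : letI := (aeval (R := K) f).toRingHom.toAlgebra
      Module.Finite (MvPolynomial ι K) (MvPolynomial σ K)) :
    Function.Injective (aeval (R := K) f) := by
  let := (aeval (R := K) f).toRingHom.toAlgebra
  have h_integral : Algebra.IsIntegral (aeval (R := K) f).range (MvPolynomial σ K) := by
    refine ⟨fun b => ?_⟩
    exact RingHom.IsIntegralElem.of_comp (f := (aeval (R := K) f).rangeRestrict.toRingHom)
      (g := algebraMap (aeval (R := K) f).range (MvPolynomial σ K))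
      (Algebra.IsIntegral.isIntegral (R := MvPolynomial ι K) b)
  rw [← Algebra.adjoin_range_eq_range_aeval] at h_integral
  have halg : Algebra.IsAlgebraic (Algebra.adjoin K (Set.range f)) (MvPolynomial σ K) :=
    inferInstance
  refine (Algebra.IsAlgebraic.isTranscendenceBasis_of_lift_le_trdeg_of_finite K f ?_).1
  rw [MvPolynomial.trdeg_of_isDomain]
  simp only [Cardinal.mk_fintype, Cardinal.lift_natCast, Fintype.card_congr e, le_refl]

theorem finrank_toAlgebra_aeval {f h : ι → MvPolynomial σ K} (e : ι ≃ σ) {w : ι → ℕ}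
    (hh : ∀ i, (h i).IsHomogeneous (w i)) (hf : ∀ i, (f i - h i).totalDegree < w i) {M : ℕ}
    (hM : ∀ j, X j ^ M ∈ Ideal.span (Set.range h)) :
    letI := (aeval (R := K) f).toRingHom.toAlgebra
    Module.finrank (MvPolynomial ι K) (MvPolynomial σ K) = ∏ i, w i := by
  have hfin := finite_toAlgebra_aeval hh hf hM
  have hinj := aeval_injective_of_finite e hfin
  let := (aeval (R := K) f).toRingHom.toAlgebra
  have hw : ∀ i, 0 < w i := fun i => (Nat.zero_le _).trans_lt (hf i)
  have : IsScalarTower K (MvPolynomial ι K) (MvPolynomial σ K) :=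
    IsScalarTower.of_algebraMap_eq fun x => ((aeval (R := K) f).commutes x).symm
  have : FaithfulSMul (MvPolynomial ι K) (MvPolynomial σ K) :=
    (faithfulSMul_iff_algebraMap_injective _ _).mpr hinj
  have hfdW : ∀ N, FiniteDimensional K (weightLE K w N) := finiteDimensional_weightLE hw
  have hfdV : ∀ N, FiniteDimensional K (weightLE K (1 : σ → ℕ) N) :=
    finiteDimensional_weightLE (by simp)
  have hdegf : ∀ i, f i ∈ weightLE K (1 : σ → ℕ) (w i) := by
    intro i
    rw [mem_weightLE_one, ← sub_add_cancel (f i) (h i)]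
    exact (totalDegree_add _ _).trans (max_le (hf i).le (hh i).totalDegree_le)
  have hWV : ∀ i, ∀ a ∈ weightLE K w i, algebraMap (MvPolynomial ι K) (MvPolynomial σ K) a ∈
      weightLE K (1 : σ → ℕ) i := by
    intro N a ha
    change aeval f a ∈ _
    rw [a.as_sum, map_sum]
    refine Submodule.sum_mem _ fun m hm => ?_
    rw [aeval_monomial, ← Algebra.smul_def]
    refine Submodule.smul_mem _ _ (mem_weightLE_one.mpr ?_)
    have hmN : Finsupp.weight w m ≤ N := ha hm
    rw [weight_eq_sum] at hmN
    rw [Finsupp.prod_fintype _ _ (by simp)]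
    refine (totalDegree_finsetProd _ _).trans ((Finset.sum_le_sum fun i _ => ?_).trans hmN)
    exact (totalDegree_pow _ _).trans (Nat.mul_le_mul_left _ (mem_weightLE_one.mp (hdegf i)))
  obtain ⟨C₁, h₁⟩ := exists_finrank_mul_le (weightLE K w) (weightLE K (1 : σ → ℕ))
    (weightLE_mono _) (exists_mem_weightLE _)
    (fun _ _ _ ha _ hb => mul_mem_weightLE ha hb) hWV
  obtain ⟨C₂, h₂⟩ := exists_finrank_le_mul (weightLE K w) (weightLE K (1 : σ → ℕ))
    (weightLE_mono _) (exists_mem_weightLE _)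
    (fun _ _ _ ha _ hb => mul_mem_weightLE ha hb) _
    (weightLE_one_le_map_mul hh hf hM)
  simp only [finrank_weightLE] at h₁ h₂
  refine le_antisymm ?_ ?_
  · refine le_of_forall_mul_le_mul_shift (f := weightCount (1 : σ → ℕ)) (c := C₁)
      one_le_weightCount_one_zero weightCount_one_le fun N => ?_
    have := weightCount_one_le_prod_mul hw N
    rw [weightCount_one_congr e] at this
    calc _ ≤ _ * ((∏ i, w i) * weightCount w N) := Nat.mul_le_mul_left _ this
      _ = (∏ i, w i) * (_ * weightCount w N) := by ring
      _ ≤ _ := Nat.mul_le_mul_left _ (h₁ N)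
  · refine le_of_forall_mul_le_mul_shift (f := weightCount (1 : σ → ℕ)) (c := C₂ + ∑ i, w i)
      one_le_weightCount_one_zero weightCount_one_le fun N => ?_
    have := prod_mul_weightCount_le w (N + C₂)
    rw [weightCount_one_congr e, add_assoc] at this
    calc _ ≤ (∏ i, w i) * (_ * weightCount w (N + C₂)) := Nat.mul_le_mul_left _ (h₂ N)
      _ = _ * ((∏ i, w i) * weightCount w (N + C₂)) := by ring
      _ ≤ _ := Nat.mul_le_mul_left _ this

/-- Bezout's theorem for a system with generic constant terms and no solutions at infinity. -/
theorem finite_and_ncard_aeval_eq_X [CharZero K] {f h : ι → MvPolynomial σ K} (e : ι ≃ σ)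
    {w : ι → ℕ} (hh : ∀ i, (h i).IsHomogeneous (w i))
    (hf : ∀ i, (f i - h i).totalDegree < w i) {M : ℕ}
    (hM : ∀ j, X j ^ M ∈ Ideal.span (Set.range h)) :
    {x : σ → AlgebraicClosure (FractionRing (MvPolynomial ι K)) |
      ∀ i, aeval x (f i) = algebraMap (MvPolynomial ι K) _ (X i)}.Finite ∧
    {x : σ → AlgebraicClosure (FractionRing (MvPolynomial ι K)) |
      ∀ i, aeval x (f i) = algebraMap (MvPolynomial ι K) _ (X i)}.ncard = ∏ i, w i := by
  have hfin := finite_toAlgebra_aeval hh hf hM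
  have hinj := aeval_injective_of_finite e hfin
  have hrank := finrank_toAlgebra_aeval e hh hf hM
  let := (aeval (R := K) f).toRingHom.toAlgebra
  have : IsScalarTower K (MvPolynomial ι K) (MvPolynomial σ K) :=
    IsScalarTower.of_algebraMap_eq fun x => ((aeval (R := K) f).commutes x).symm
  have : FaithfulSMul (MvPolynomial ι K) (MvPolynomial σ K) :=
    (faithfulSMul_iff_algebraMap_injective _ _).mpr hinj
  have : CharZero (MvPolynomial ι K) := charZero_of_injective_algebraMap (C_injective ι K)
  have hcard := natCard_algHom_algebraicClosure
    (A := MvPolynomial ι K) (B := MvPolynomial σ K)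
  rw [hrank] at hcard
  set Ω := AlgebraicClosure (FractionRing (MvPolynomial ι K))
  set S := {x : σ → Ω | ∀ i, aeval x (f i) = algebraMap (MvPolynomial ι K) _ (X i)}
  have hx : ∀ x ∈ S, ∀ a : MvPolynomial ι K,
      aeval (R := K) x (aeval f a) = algebraMap (MvPolynomial ι K) Ω a := by
    intro x hx a
    have : (aeval (R := K) x).comp (aeval f) = IsScalarTower.toAlgHom K (MvPolynomial ι K) Ω :=
      algHom_ext fun i => by simpa using hx i
    exact DFunLike.congr_fun this a
  let E : S ≃ (MvPolynomial σ K →ₐ[MvPolynomial ι K] Ω) :=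
    { toFun := fun x => { (aeval (R := K) (x : σ → Ω)).toRingHom with commutes' := hx x x.2 }
      invFun := fun φ => ⟨fun j => φ (X j), fun i => by
        have h1 : aeval (R := K) (fun j => φ (X j)) = φ.restrictScalars K :=
          algHom_ext fun j => by simp
        rw [h1, ← φ.commutes (X i)]
        change φ (f i) = φ (aeval f (X i))
        rw [aeval_X]⟩
      left_inv := fun x => by
        ext j
        exact aeval_X _ _
      right_inv := fun φ => by
        have h1 : aeval (R := K) (fun j => φ (X j)) = φ.restrictScalars K :=
          algHom_ext fun j => by simp
        ext b
        exact DFunLike.congr_fun h1 b }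
  have hS : Nat.card S = ∏ i, w i := (Nat.card_congr E).trans hcard
  rw [Nat.card_coe_set_eq] at hS
  refine ⟨Set.finite_of_ncard_ne_zero ?_, hS⟩
  rw [hS]
  exact Finset.prod_ne_zero_iff.mpr fun i _ => ((Nat.zero_le _).trans_lt (hf i)).ne'

end Bezout

section Valuation

theorem exists_valuationSubring_of_transcendental {K Ω : Type*} [Field K] [Field Ω] [Algebra K Ω]
    (F : IntermediateField K Ω) {t : Ω} (ht : Transcendental F t) :
    ∃ V : ValuationSubring Ω, (∀ a ∈ F, a ∈ V) ∧ t ∉ V := by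
  by_contra! h
  have h1 : t ∈ (integralClosure (Subring.closure (F : Set Ω)) Ω).toSubring := by
    rw [← iInf_valuationSubring_superset, Subring.mem_iInf]
    exact fun V => h V.1 fun a ha => V.2 ha
  obtain ⟨p, hp, hp0⟩ : IsIntegral (Subring.closure (F : Set Ω)) t := h1
  have hle : Subring.closure (F : Set Ω) ≤ F.toSubfield.toSubring :=
    Subring.closure_le.mpr fun a ha => ha
  have h2 : IsIntegral F t := by
    refine ⟨p.map (Subring.inclusion hle), hp.map _, ?_⟩
    rw [Polynomial.eval₂_map]
    exact hp0
  exact ht h2.isAlgebraic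

variable {K : Type*} [Field K]

theorem exists_valuationSubring_tail {Ω : Type*} [Field Ω] (φ : K →+* Ω) {m : ℕ}
    {α : Fin (m + 1) → Ω} (hα : ∀ p, p ≠ 0 → eval₂ φ α p ≠ 0) :
    ∃ V : ValuationSubring Ω, 1 < V.valuation (α 0) ∧
      ∀ p, p ≠ 0 → V.valuation (eval₂ φ (fun j => α (Fin.succ j)) p) = 1 := by
  let := φ.toAlgebra
  have hind : AlgebraicIndependent K α := by
    rw [algebraicIndependent_iff]
    intro p hp
    by_contra hne
    exact hα p hne hp
  have htr := hind.transcendental_adjoin (s := Set.range Fin.succ) (i := 0)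
    (by rintro ⟨j, hj⟩; exact Fin.succ_ne_zero j hj)
  rw [← IntermediateField.transcendental_adjoin_iff] at htr
  obtain ⟨V, hV, ht⟩ := exists_valuationSubring_of_transcendental _ htr
  refine ⟨V, ?_, fun p hp => ?_⟩
  · rwa [← not_le, V.valuation_le_one_iff]
  have hmem : eval₂ φ (fun j => α (Fin.succ j)) p ∈
      IntermediateField.adjoin K (α '' Set.range Fin.succ) := by
    have : (aeval fun j => α (Fin.succ j)) p ∈ (IntermediateField.adjoin K
        (α '' Set.range Fin.succ)).toSubalgebra := by
      refine (Algebra.adjoin_le ?_ : Algebra.adjoin K (α '' Set.range Fin.succ) ≤ _) ?_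
      · exact IntermediateField.subset_adjoin K _
      · rw [← Set.range_comp, Algebra.adjoin_range_eq_range_aeval]
        exact ⟨p, rfl⟩
    exact this
  have hne : eval₂ φ (fun j => α (Fin.succ j)) p ≠ 0 := by
    have h0 := hα (rename Fin.succ p)
      ((rename_injective _ (Fin.succ_injective m)).ne_iff' (map_zero _) |>.mpr hp)
    rwa [eval₂_rename] at h0
  refine le_antisymm ((V.valuation_le_one_iff _).mpr (hV _ hmem)) ?_
  have := (V.valuation_le_one_iff _).mpr (hV _ (inv_mem hmem))
  rwa [map_inv₀, inv_le_one₀ (zero_lt_iff.mpr ((Valuation.ne_zero_iff _).mpr hne))] at this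

end Valuation

section PowerSums

/-- The weighted power sum `∑ α_j^e x_j^(d+eδ)`. -/
def wsum {Ω ι : Type*} [CommRing Ω] [Fintype ι] (d δ : ℕ) (α x : ι → Ω) (e : ℕ) : Ω :=
  ∑ j, α j ^ e * x j ^ (d + e * δ)

theorem wsum_mul {Ω ι : Type*} [CommRing Ω] [Fintype ι] (d δ : ℕ) (α x : ι → Ω) (u : Ω) (e : ℕ) :
    wsum d δ α (fun j => x j * u) e = wsum d δ α x e * u ^ (d + e * δ) := by
  simp only [wsum, mul_pow, Finset.sum_mul, mul_assoc]

theorem wsum_succ {Ω : Type*} [CommRing Ω] (d δ : ℕ) {m : ℕ} (α x : Fin (m + 1) → Ω) (e : ℕ) :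
    wsum d δ α x e = α 0 ^ e * x 0 ^ (d + e * δ) +
      wsum d δ (fun j => α (Fin.succ j)) (fun j => x (Fin.succ j)) e :=
  Fin.sum_univ_succ _

theorem map_wsum {Ω Ω' ι : Type*} [CommRing Ω] [CommRing Ω'] [Fintype ι] (f : Ω →+* Ω') (d δ : ℕ)
    (α x : ι → Ω) (e : ℕ) :
    f (wsum d δ α x e) = wsum d δ (fun j => f (α j)) (fun j => f (x j)) e := by
  simp [wsum]

variable {K : Type*} [Field K] {d δ q : ℕ} {C : ℕ → K}

theorem valuation_wsum_term_le_one {Ω : Type*} [Field Ω] {φ : K →+* Ω} (V : ValuationSubring Ω)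
    (hφ : ∀ c, V.valuation (φ c) ≤ 1) (hd : 0 < d) {m e : ℕ} {α y : Fin (m + 1) → Ω}
    (hα : 1 < V.valuation (α 0)) (hα' : ∀ j : Fin m, α j.succ ∈ V)
    (hy : ∀ j : Fin m, y j.succ ∈ V)
    (hC : C e ≠ 0 → e = d * (q + 1) ∧ d = δ + 1)
    (hx : wsum d δ α y e + φ (C e) * wsum d δ α y q ^ d = 0) :
    V.valuation (α 0 ^ e * y 0 ^ (d + e * δ)) ≤ 1 := by
  have hrest : ∀ e, V.valuation (wsum d δ (fun j => α (Fin.succ j)) (fun j => y (Fin.succ j)) e)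
      ≤ 1 := by
    intro e
    rw [V.valuation_le_one_iff]
    exact sum_mem fun j _ => mul_mem (pow_mem (hα' j) _) (pow_mem (hy j) _)
  by_contra! hlt
  have hS : V.valuation (wsum d δ α y e) = V.valuation (α 0 ^ e * y 0 ^ (d + e * δ)) := by
    rw [wsum_succ]
    exact Valuation.map_add_eq_of_lt_left _ ((hrest e).trans_lt hlt)
  by_cases hc : C e = 0
  · rw [hc, map_zero, zero_mul, add_zero] at hx
    rw [← hS, hx, map_zero] at hlt
    exact not_lt_zero hlt
  obtain ⟨he, rfl⟩ := hC hc
  rw [← hS, eq_neg_of_add_eq_zero_left hx, Valuation.map_neg, map_mul, map_pow] at hlt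
  have h1 : 1 < V.valuation (wsum (δ + 1) δ α y q) := by
    by_contra! hle
    exact hlt.not_ge (mul_le_one' (hφ _) (pow_le_one' hle _))
  have h2 : V.valuation (wsum (δ + 1) δ α y q) =
      V.valuation (α 0 ^ q * y 0 ^ (δ + 1 + q * δ)) := by
    rw [wsum_succ]
    refine Valuation.map_add_eq_of_lt_left _ ((hrest q).trans_lt ?_)
    by_contra! hle
    refine h1.not_ge ?_
    rw [wsum_succ]
    exact Valuation.map_add_le _ hle (hrest q)
  have h3 : α 0 ^ e * y 0 ^ (δ + 1 + e * δ) =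
      α 0 ^ (δ + 1) * (α 0 ^ q * y 0 ^ (δ + 1 + q * δ)) ^ (δ + 1) := by
    subst he
    ring
  rw [h3, map_mul, map_pow V.valuation (α 0 ^ q * _), ← h2, map_pow,
    eq_neg_of_add_eq_zero_left hx, Valuation.map_neg, map_mul, map_pow] at hS
  have hpos : 0 < V.valuation (wsum (δ + 1) δ α y q) ^ (δ + 1) :=
    pow_pos (zero_lt_one.trans h1) _
  have h4 := mul_le_mul_left (hφ (C e)) (V.valuation (wsum (δ + 1) δ α y q) ^ (δ + 1))
  rw [hS, one_mul] at h4
  have h5 : 1 < V.valuation (α 0) ^ (δ + 1) := one_lt_pow₀ hα (by omega)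
  exact (lt_mul_of_one_lt_left hpos h5).not_ge h4


theorem eq_zero_of_wsum_add_eq_zero_of_normalized {Ω : Type*} [Field Ω] {φ : K →+* Ω}
    (V : ValuationSubring Ω) (hd : 0 < d) {m : ℕ} {α y : Fin (m + 1) → Ω}
    (hα : 1 < V.valuation (α 0))
    (hα' : ∀ p, p ≠ 0 → V.valuation (eval₂ φ (fun j => α (Fin.succ j)) p) = 1)
    (ih : ∀ (φ' : K →+* IsLocalRing.ResidueField V) (α' : Fin m → IsLocalRing.ResidueField V),
      (∀ p, p ≠ 0 → eval₂ φ' α' p ≠ 0) → ∀ E : Finset ℕ, E.card = m →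
      (∀ e ∈ E, C e ≠ 0 → e = d * (q + 1) ∧ d = δ + 1) → ∀ x : Fin m → IsLocalRing.ResidueField V,
      (∀ e ∈ E, wsum d δ α' x e + φ' (C e) * wsum d δ α' x q ^ d = 0) → x = 0)
    {E : Finset ℕ} (hE : E.card = m + 1)
    (hC : ∀ e ∈ E, C e ≠ 0 → e = d * (q + 1) ∧ d = δ + 1)
    (hy : ∀ j : Fin m, y j.succ ∈ V) {j₀ : Fin m} (hy0 : y j₀.succ = 1)
    (hx : ∀ e ∈ E, wsum d δ α y e + φ (C e) * wsum d δ α y q ^ d = 0) : False := by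
  have hφ : ∀ c, V.valuation (φ c) ≤ 1 := by
    intro c
    rcases eq_or_ne c 0 with rfl | hc
    · simp
    · have := hα' (MvPolynomial.C c) (by simpa using hc)
      rw [eval₂_C] at this
      exact this.le
  have hαV : ∀ j : Fin m, α j.succ ∈ V := by
    intro j
    have := hα' (X j) (X_ne_zero j)
    rw [eval₂_X] at this
    exact (V.valuation_le_one_iff _).mp this.le
  have hEne : E.Nonempty := Finset.card_pos.mp (by omega)
  set M := E.max' hEne
  have hM : M ∈ E := E.max'_mem hEne
  have hlt : ∀ e ∈ E.erase M, e < M := fun e he => E.lt_max'_of_mem_erase_max' hEne he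
  obtain ⟨e₁, he₁⟩ : (E.erase M).Nonempty := by
    rw [← Finset.card_pos, Finset.card_erase_of_mem hM]
    have := j₀.pos
    omega
  have hM0 : M ≠ 0 := ((Nat.zero_le _).trans_lt (hlt e₁ he₁)).ne'
  have hT := valuation_wsum_term_le_one V hφ hd hα hαV hy (hC M hM) (hx M hM)
  rw [map_mul, map_pow, map_pow] at hT
  have hy1 : V.valuation (y 0) < 1 := by
    by_contra! hle
    exact hT.not_gt (one_lt_mul_of_lt_of_le' (one_lt_pow₀ hα hM0) (one_le_pow_of_one_le' hle _))
  have hlt1 : ∀ e < M, V.valuation (α 0 ^ e * y 0 ^ (d + e * δ)) < 1 := by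
    intro e he
    by_contra! hle
    have h1 : V.valuation (α 0 ^ e * y 0 ^ (d + e * δ)) ^ M =
        (V.valuation (α 0) ^ M * V.valuation (y 0) ^ (d + M * δ)) ^ e *
          V.valuation (y 0) ^ (d * (M - e)) := by
      obtain ⟨k, hk⟩ := Nat.exists_eq_add_of_le he.le
      rw [map_mul, map_pow, map_pow, hk, Nat.add_sub_cancel_left]
      simp only [mul_pow, ← pow_mul, mul_assoc, ← pow_add]
      congr 2 <;> ring
    refine (one_le_pow_of_one_le' hle M).not_gt ?_
    rw [h1]
    exact mul_lt_one_of_nonneg_of_lt_one_right (pow_le_one' hT _) zero_le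
      (pow_lt_one₀ zero_le hy1 (Nat.mul_ne_zero hd.ne' (by omega)))
  let a : Fin m → V := fun j => ⟨α j.succ, hαV j⟩
  let b : Fin m → V := fun j => ⟨y j.succ, hy j⟩
  let φV : K →+* V := φ.codRestrict V.toSubring fun c => (V.valuation_le_one_iff _).mp (hφ c)
  let τ : ∀ e, e < M → V := fun e he =>
    ⟨α 0 ^ e * y 0 ^ (d + e * δ), (V.valuation_le_one_iff _).mp (hlt1 e he).le⟩
  have hτ : ∀ e he, IsLocalRing.residue V (τ e he) = 0 := by
    intro e he
    rw [IsLocalRing.residue_eq_zero_iff, V.valuation_lt_one_iff]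
    exact hlt1 e he
  have hsum : ∀ e, ((wsum d δ a b e : V) : Ω) =
      wsum d δ (fun j => α (Fin.succ j)) (fun j => y (Fin.succ j)) e :=
    fun e => map_wsum V.subtype d δ a b e
  have hres := ih ((IsLocalRing.residue V).comp φV) (fun j => IsLocalRing.residue V (a j)) ?_
    (E.erase M) (by rw [Finset.card_erase_of_mem hM, hE]; rfl)
    (fun e he => hC e (Finset.mem_of_mem_erase he)) (fun j => IsLocalRing.residue V (b j)) ?_
  · have h0 := congrFun hres j₀
    have : b j₀ = 1 := Subtype.ext hy0
    simp [this] at h0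
  · intro p hp h0
    have h0 := (eval₂_comp_left (IsLocalRing.residue V) φV a p).trans h0
    rw [IsLocalRing.residue_eq_zero_iff, V.valuation_lt_one_iff] at h0
    have h1 : ((eval₂ φV a p : V) : Ω) = eval₂ φ (fun j => α (Fin.succ j)) p :=
      eval₂_comp_left V.subtype φV a p
    rw [h1, hα' p hp] at h0
    exact lt_irrefl _ h0
  · intro e he
    have heM := hlt e he
    have heE := Finset.mem_of_mem_erase he
    rw [← map_wsum, ← map_wsum]
    by_cases hc : C e = 0
    · have h1 : τ e heM + wsum d δ a b e = 0 := by
        refine Subtype.ext ?_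
        have := hx e heE
        rw [hc, map_zero, zero_mul, add_zero, wsum_succ, ← hsum] at this
        exact this
      have h2 := congrArg (IsLocalRing.residue V) h1
      rw [map_add, hτ _ heM, zero_add, map_zero] at h2
      rw [h2, hc, map_zero, zero_mul, add_zero]
    · have hqM : q < M := by
        obtain ⟨h1, -⟩ := hC e heE hc
        have : q + 1 ≤ d * (q + 1) := Nat.le_mul_of_pos_left _ hd
        omega
      have h1 : τ e heM + wsum d δ a b e + φV (C e) * (τ q hqM + wsum d δ a b q) ^ d = 0 := by
        refine Subtype.ext ?_
        have := hx e heE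
        rw [wsum_succ, wsum_succ, ← hsum, ← hsum] at this
        exact this
      have h2 := congrArg (IsLocalRing.residue V) h1
      rw [map_add, map_add, map_mul, map_pow, map_add, hτ _ heM, hτ _ hqM, zero_add, zero_add,
        map_zero] at h2
      exact h2


/-- A perturbed system of as many weighted power sum equations as unknowns, with algebraically
independent coefficients, has only the trivial solution. -/
theorem eq_zero_of_wsum_add_eq_zero (hd : 0 < d) (m : ℕ) {Ω : Type*} [Field Ω] (φ : K →+* Ω)
    (α : Fin m → Ω) (hα : ∀ p, p ≠ 0 → eval₂ φ α p ≠ 0) (E : Finset ℕ) (hE : E.card = m)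
    (hC : ∀ e ∈ E, C e ≠ 0 → e = d * (q + 1) ∧ d = δ + 1) (x : Fin m → Ω)
    (hx : ∀ e ∈ E, wsum d δ α x e + φ (C e) * wsum d δ α x q ^ d = 0) : x = 0 := by
  induction m generalizing Ω E with
  | zero => exact Subsingleton.elim _ _
  | succ m ih =>
    obtain ⟨V, hV, hV'⟩ := exists_valuationSubring_tail φ hα
    by_cases hs : ∀ j : Fin m, x j.succ = 0
    · have hw : ∀ e, wsum d δ α x e = α 0 ^ e * x 0 ^ (d + e * δ) := by
        intro e
        rw [wsum_succ, wsum, Finset.sum_eq_zero, add_zero]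
        intro j _
        rw [hs, zero_pow (by omega), mul_zero]
      have hα0 : α 0 ≠ 0 := by
        rintro h
        rw [h, map_zero] at hV
        exact not_lt_zero hV
      suffices h0 : x 0 = 0 by
        ext j
        exact Fin.cases h0 hs j
      by_contra h0
      obtain ⟨e, he⟩ : E.Nonempty := Finset.card_pos.mp (by omega)
      have h1 := hx e he
      rw [hw, hw] at h1
      by_cases hc : C e = 0
      · rw [hc, map_zero, zero_mul, add_zero] at h1
        exact mul_ne_zero (pow_ne_zero _ hα0) (pow_ne_zero _ h0) h1
      · obtain ⟨h2, rfl⟩ := hC e he hc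
        have h3 : (α 0 ^ q * x 0 ^ (δ + 1 + q * δ)) ^ (δ + 1) * (α 0 ^ (δ + 1) + φ (C e)) = 0 := by
          rw [← h1, h2]
          ring
        have h4 := (mul_eq_zero.mp h3).resolve_left
          (pow_ne_zero _ (mul_ne_zero (pow_ne_zero _ hα0) (pow_ne_zero _ h0)))
        have h5 := hV' (MvPolynomial.C (C e)) (by simpa using hc)
        rw [eval₂_C] at h5
        have h6 := congrArg V.valuation (eq_neg_of_add_eq_zero_left h4)
        rw [Valuation.map_neg, h5, map_pow] at h6
        exact (one_lt_pow₀ hV (Nat.succ_ne_zero δ)).ne' h6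
    · exfalso
      push Not at hs
      obtain ⟨j₁, hj₁⟩ := hs
      have : Nonempty (Fin m) := ⟨j₁⟩
      obtain ⟨j₀, hj₀⟩ := Finite.exists_max fun j : Fin m => V.valuation (x j.succ)
      have hne : x j₀.succ ≠ 0 := by
        intro h
        have := hj₀ j₁
        rw [h, map_zero, le_zero_iff, Valuation.zero_iff] at this
        exact hj₁ this
      refine eq_zero_of_wsum_add_eq_zero_of_normalized (C := C) (q := q) (δ := δ) V hd hV hV' ih hE
        hC (y := fun j => x j * (x j₀.succ)⁻¹) (fun j => ?_) (mul_inv_cancel₀ hne) fun e he => ?_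
      · rw [← V.valuation_le_one_iff, map_mul, map_inv₀]
        exact mul_inv_le_one_of_le₀ (hj₀ j) zero_le
      · rw [wsum_mul, wsum_mul]
        by_cases hc : C e = 0
        · have := hx e he
          rw [hc, map_zero, zero_mul, add_zero] at this
          rw [this, hc, map_zero, zero_mul, zero_mul, add_zero]
        · obtain ⟨h2, h3⟩ := hC e he hc
          have h4 : d + e * δ = (d + q * δ) * d := by
            subst h2 h3
            ring
          rw [mul_pow, ← pow_mul, ← h4, ← mul_assoc, ← add_mul, hx e he, zero_mul]

end PowerSums

section LieDegree

variable {R : Type*} [CommRing R]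

theorem lieD_apply {n : ℕ} (g : Fin n → MvPolynomial (Fin n) R) (p : MvPolynomial (Fin n) R) :
    lieD g p = ∑ i, g i * pderiv i p := by
  have h : lieD g = ∑ i, g i • pderiv (R := R) i := by
    refine derivation_ext fun j => ?_
    rw [lieD, mkDerivation_X, ← Derivation.coeFnAddMonoidHom_apply, map_sum, Finset.sum_apply]
    simp [pderiv_X, Pi.single_apply]
  rw [h, ← Derivation.coeFnAddMonoidHom_apply, map_sum, Finset.sum_apply]
  rfl

theorem totalDegree_pderiv_le {σ : Type*} (i : σ) (p : MvPolynomial σ R) :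
    (pderiv i p).totalDegree ≤ p.totalDegree - 1 := by
  conv_lhs => rw [← sum_homogeneousComponent p, map_sum]
  refine totalDegree_finsetSum_le fun k hk => ?_
  have h := (homogeneousComponent_isHomogeneous k p).pderiv (i := i)
  refine h.totalDegree_le.trans ?_
  have := Finset.mem_range.1 hk
  omega

theorem totalDegree_lieD_le_sub {n a : ℕ} {g : Fin n → MvPolynomial (Fin n) R}
    (hg : ∀ i, (g i).totalDegree ≤ a) (p : MvPolynomial (Fin n) R) :
    (lieD g p).totalDegree ≤ a + (p.totalDegree - 1) := by
  rw [lieD_apply]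
  exact totalDegree_finsetSum_le fun i _ => (totalDegree_mul _ _).trans
    (add_le_add (hg i) (totalDegree_pderiv_le i p))

theorem totalDegree_lieD_le {n a : ℕ} {g : Fin n → MvPolynomial (Fin n) R}
    (hg : ∀ i, (g i).totalDegree ≤ a + 1) (p : MvPolynomial (Fin n) R) :
    (lieD g p).totalDegree ≤ p.totalDegree + a := by
  rcases Nat.eq_zero_or_pos p.totalDegree with h | h
  · rw [totalDegree_eq_zero_iff_eq_C] at h
    rw [h]
    simp
  · have := totalDegree_lieD_le_sub hg p
    omega

theorem isHomogeneous_lieD {n a m : ℕ} {g : Fin n → MvPolynomial (Fin n) R}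
    (hg : ∀ i, (g i).IsHomogeneous (a + 1)) {p : MvPolynomial (Fin n) R}
    (hp : p.IsHomogeneous m) (hm : 0 < m) : (lieD g p).IsHomogeneous (m + a) := by
  rw [lieD_apply]
  refine IsHomogeneous.sum _ _ _ fun i _ => ?_
  have h := (hg i).mul (hp.pderiv (i := i))
  rwa [show a + 1 + (m - 1) = m + a by omega] at h

theorem isHomogeneous_iterate_lieD {n a m : ℕ} {g : Fin n → MvPolynomial (Fin n) R}
    (hg : ∀ i, (g i).IsHomogeneous (a + 1)) {p : MvPolynomial (Fin n) R}
    (hp : p.IsHomogeneous m) (hm : 0 < m) (k : ℕ) :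
    ((lieD g)^[k] p).IsHomogeneous (m + k * a) := by
  induction k with
  | zero => simpa using hp
  | succ k ih =>
    rw [Function.iterate_succ_apply', Nat.succ_mul, ← add_assoc]
    exact isHomogeneous_lieD hg ih (by omega)

theorem totalDegree_iterate_lieD_sub_lt {n a m : ℕ} {g g' : Fin n → MvPolynomial (Fin n) R}
    (hg' : ∀ i, (g' i).IsHomogeneous (a + 1)) (hg : ∀ i, (g i - g' i).totalDegree ≤ a)
    {p p' : MvPolynomial (Fin n) R} (hp' : p'.IsHomogeneous m) (hp : (p - p').totalDegree < m)
    (k : ℕ) : ((lieD g)^[k] p - (lieD g')^[k] p').totalDegree < m + k * a := by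
  have hgt : ∀ i, (g i).totalDegree ≤ a + 1 := fun i => by
    have h : g i = (g i - g' i) + g' i := by ring
    rw [h]
    exact (totalDegree_add _ _).trans
      (max_le ((hg i).trans (Nat.le_succ a)) (hg' i).totalDegree_le)
  induction k with
  | zero => simpa using hp
  | succ k ih =>
    rw [Function.iterate_succ_apply', Function.iterate_succ_apply']
    set P := (lieD g)^[k] p
    have hH := isHomogeneous_iterate_lieD hg' hp' (by omega) k
    set H := (lieD g')^[k] p'
    have h : lieD g P - lieD g' H = lieD g (P - H) + lieD (fun i => g i - g' i) H := by
      simp only [lieD_apply, map_sub, ← Finset.sum_add_distrib, ← Finset.sum_sub_distrib]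
      exact Finset.sum_congr rfl fun i _ => by ring
    rw [h]
    refine (totalDegree_add _ _).trans_lt (max_lt ?_ ?_)
    · refine (totalDegree_lieD_le hgt _).trans_lt ?_
      rw [Nat.succ_mul]
      omega
    · refine (totalDegree_lieD_le_sub hg _).trans_lt ?_
      have := hH.totalDegree_le
      rw [Nat.succ_mul]
      omega

theorem map_lieD {S : Type*} [CommRing S] {n : ℕ} (φ : R →+* S)
    (g : Fin n → MvPolynomial (Fin n) R) (p : MvPolynomial (Fin n) R) :
    map φ (lieD g p) = lieD (fun i => map φ (g i)) (map φ p) := by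
  simp [lieD_apply, pderiv_map]

theorem map_iterate_lieD {S : Type*} [CommRing S] {n : ℕ} (φ : R →+* S)
    (g : Fin n → MvPolynomial (Fin n) R) (p : MvPolynomial (Fin n) R) (k : ℕ) :
    map φ ((lieD g)^[k] p) = (lieD fun i => map φ (g i))^[k] (map φ p) := by
  induction k with
  | zero => rfl
  | succ k ih => rw [Function.iterate_succ_apply', Function.iterate_succ_apply', map_lieD, ih]

end LieDegree

section TopForms

variable (R : Type*) [CommRing R] (n d D : ℕ) [NeZero n]

/-- The leading form of `gsys K n d D α 0`. -/
def powerSum : MvPolynomial (Fin n) R :=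
  X 0 ^ d + ∑ j ∈ Finset.univ.filter (fun j : Fin n => j ≠ 0), X j ^ d

/-- The degree `D` part of `gsys R n d D α`. -/
def gtop (α : {i : Fin n // i ≠ 0} → R) : Fin n → MvPolynomial (Fin n) R := fun i =>
  if h : i = 0 then (if d = D then powerSum R n d else 0) else C (α ⟨i, h⟩) * X i ^ D

variable {R n}

/-- The variable `X 0` followed by the iterated Lie derivatives of `h`. -/
def lieSys (g : Fin n → MvPolynomial (Fin n) R) (h : MvPolynomial (Fin n) R) :
    ℕ → MvPolynomial (Fin n) R
  | 0 => X 0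
  | k + 1 => (lieD g)^[k] h

/-- The degrees of the members of `lieSys (gtop R n d D α) (powerSum R n d)`. -/
def lieWeight : ℕ → ℕ
  | 0 => 1
  | k + 1 => d + k * (D - 1)

variable {d D}

theorem isHomogeneous_powerSum : (powerSum R n d).IsHomogeneous d :=
  (isHomogeneous_X_pow _ _).add (IsHomogeneous.sum _ _ _ fun _ _ => isHomogeneous_X_pow _ _)

theorem isHomogeneous_gtop (hD : 0 < D) (α : {i : Fin n // i ≠ 0} → R) (i : Fin n) :
    (gtop R n d D α i).IsHomogeneous (D - 1 + 1) := by
  rw [Nat.sub_add_cancel hD, gtop]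
  split_ifs with h h'
  · exact h' ▸ isHomogeneous_powerSum
  · exact isHomogeneous_zero _ _ _
  · exact (isHomogeneous_X_pow _ _).C_mul _

theorem totalDegree_X_add_one_pow_sub_le {σ : Type*} (i : σ) (k : ℕ) :
    ((X i + 1 : MvPolynomial σ R) ^ k - X i ^ k).totalDegree ≤ k - 1 := by
  rcases k with _ | k
  · simp
  have h : (X i + 1 : MvPolynomial σ R) ^ (k + 1) - X i ^ (k + 1) =
      ∑ m ∈ Finset.range (k + 1), C (((k + 1).choose m : ℕ) : R) * X i ^ m := by
    rw [add_pow, Finset.sum_range_succ]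
    simp [mul_comm]
  rw [h]
  refine totalDegree_finsetSum_le fun m hm => ?_
  refine ((isHomogeneous_X_pow i m).C_mul _).totalDegree_le.trans ?_
  have := Finset.mem_range.1 hm
  omega

theorem totalDegree_gsys_zero_sub_le (α : {i : Fin n // i ≠ 0} → R) :
    (gsys R n d D α 0 - powerSum R n d).totalDegree ≤ d - 1 := by
  rw [gsys, dif_pos rfl, powerSum, add_sub_add_left_eq_sub, ← Finset.sum_sub_distrib]
  exact totalDegree_finsetSum_le fun j _ => totalDegree_X_add_one_pow_sub_le j d

theorem totalDegree_gsys_sub_gtop_le (hdD : d ≤ D) (α : {i : Fin n // i ≠ 0} → R) (i : Fin n) :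
    (gsys R n d D α i - gtop R n d D α i).totalDegree ≤ D - 1 := by
  by_cases hi : i = 0
  · subst hi
    have h := totalDegree_gsys_zero_sub_le (d := d) (D := D) α
    by_cases hd : d = D
    · rw [gtop, dif_pos rfl, if_pos hd]
      omega
    · rw [gtop, dif_pos rfl, if_neg hd, sub_zero]
      have h2 : gsys R n d D α 0 = (gsys R n d D α 0 - powerSum R n d) + powerSum R n d := by ring
      rw [h2]
      refine (totalDegree_add _ _).trans (max_le (by omega) ?_)
      exact isHomogeneous_powerSum.totalDegree_le.trans (by omega)
  · simp [gsys, gtop, hi]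

theorem isHomogeneous_lieSys (hd : 0 < d) (hD : 0 < D) (α : {i : Fin n // i ≠ 0} → R) (k : ℕ) :
    (lieSys (gtop R n d D α) (powerSum R n d) k).IsHomogeneous (lieWeight d D k) := by
  cases k with
  | zero => exact isHomogeneous_X _ _
  | succ k => exact isHomogeneous_iterate_lieD (isHomogeneous_gtop hD α) isHomogeneous_powerSum hd k

theorem totalDegree_lieSys_sub_lt (hd : 0 < d) (hD : 0 < D) (hdD : d ≤ D)
    (α : {i : Fin n // i ≠ 0} → R) (k : ℕ) :
    (lieSys (gsys R n d D α) (gsys R n d D α 0) k -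
      lieSys (gtop R n d D α) (powerSum R n d) k).totalDegree < lieWeight d D k := by
  cases k with
  | zero => simp [lieSys, lieWeight]
  | succ k =>
    refine totalDegree_iterate_lieD_sub_lt (isHomogeneous_gtop hD α)
      (totalDegree_gsys_sub_gtop_le hdD α) isHomogeneous_powerSum ?_ k
    have := totalDegree_gsys_zero_sub_le (d := d) (D := D) α
    omega

theorem map_powerSum {S : Type*} [CommRing S] (φ : R →+* S) :
    map φ (powerSum R n d) = powerSum S n d := by
  simp [powerSum]

theorem map_gtop {S : Type*} [CommRing S] (φ : R →+* S) (α : {i : Fin n // i ≠ 0} → R)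
    (i : Fin n) : map φ (gtop R n d D α i) = gtop S n d D (fun j => φ (α j)) i := by
  simp only [gtop]
  split_ifs <;> simp [map_powerSum]

theorem map_lieSys {S : Type*} [CommRing S] (φ : R →+* S) (α : {i : Fin n // i ≠ 0} → R) (k : ℕ) :
    map φ (lieSys (gtop R n d D α) (powerSum R n d) k) =
      lieSys (gtop S n d D fun j => φ (α j)) (powerSum S n d) k := by
  cases k with
  | zero => simp [lieSys]
  | succ k =>
    simp only [lieSys]
    rw [map_iterate_lieD, map_powerSum]
    simp_rw [map_gtop]

end TopForms

section Derivations

variable {R A : Type*} [CommRing R] [CommRing A] [Algebra R A]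

theorem Derivation.iterate_mul (L : Derivation R A A) (k : ℕ) (a b : A) :
    L^[k] (a * b) =
      ∑ ij ∈ Finset.HasAntidiagonal.antidiagonal k, k.choose ij.1 • (L^[ij.1] a * L^[ij.2] b) := by
  induction k with
  | zero => simp
  | succ k ih =>
    rw [Finset.sum_antidiagonal_choose_succ_nsmul (M := A) (fun i j => L^[i] a * L^[j] b) k]
    simp only [Function.iterate_succ_apply', ih, map_sum, map_nsmul, Derivation.leibniz, smul_add,
      Finset.sum_add_distrib, smul_eq_mul]
    congr 1
    refine Finset.sum_congr rfl fun ⟨i, j⟩ hij => ?_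
    rw [k.choose_symm_of_eq_add (Finset.HasAntidiagonal.mem_antidiagonal.1 hij).symm, mul_comm]

theorem Derivation.iterate_one (L : Derivation R A A) {k : ℕ} (hk : k ≠ 0) : L^[k] 1 = 0 := by
  obtain ⟨k, rfl⟩ := Nat.exists_eq_succ_of_ne_zero hk
  rw [Function.iterate_succ_apply, Derivation.map_one_eq_zero, iterate_map_zero]

/-- If all but the `ℓ`-th iterated derivative of `y` vanish at a point, then only the `m ℓ`-th
iterated derivative of `y ^ m` can be nonzero there. -/
theorem Derivation.exists_map_iterate_pow_eq {B : Type*} [CommRing B] (L : Derivation R A A)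
    (f : A →+* B) (y : A) {N ℓ : ℕ} (hy : ∀ k ≤ N, k ≠ ℓ → f (L^[k] y) = 0) (m : ℕ) :
    ∃ c : ℕ, ∀ k ≤ N, f (L^[k] (y ^ m)) = if k = m * ℓ then c * f (L^[ℓ] y) ^ m else 0 := by
  induction m with
  | zero =>
    refine ⟨1, fun k _ => ?_⟩
    rw [pow_zero, zero_mul]
    split_ifs with h
    · simp [h]
    · rw [L.iterate_one h, map_zero]
  | succ m ih =>
    obtain ⟨c, hc⟩ := ih
    refine ⟨((m + 1) * ℓ).choose (m * ℓ) * c, fun k hk => ?_⟩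
    rw [pow_succ, L.iterate_mul, map_sum]
    have hterm : ∀ ij ∈ Finset.HasAntidiagonal.antidiagonal k, ij ≠ (m * ℓ, ℓ) →
        f (k.choose ij.1 • (L^[ij.1] (y ^ m) * L^[ij.2] y)) = 0 := by
      rintro ⟨i, j⟩ hij hne
      have hij' := Finset.HasAntidiagonal.mem_antidiagonal.1 hij
      simp only at hij'
      rw [map_nsmul, map_mul]
      by_cases hj : j = ℓ
      · rw [hc i (by omega), if_neg, zero_mul, smul_zero]
        rintro rfl
        exact hne (by rw [hj])
      · rw [hy j (by omega) hj, mul_zero, smul_zero]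
    split_ifs with h
    · rw [Finset.sum_eq_single_of_mem (m * ℓ, ℓ)
        (Finset.HasAntidiagonal.mem_antidiagonal.2 (by rw [h, Nat.succ_mul])) hterm]
      rw [map_nsmul, map_mul, hc _ (by rw [h, Nat.succ_mul] at hk; omega), if_pos rfl, ← h,
        nsmul_eq_mul]
      push_cast
      ring
    · refine Finset.sum_eq_zero fun ij hij => hterm ij hij ?_
      rintro rfl
      exact h (by rw [← Finset.HasAntidiagonal.mem_antidiagonal.1 hij, Nat.succ_mul])

end Derivations

section Vanishing

theorem eq_zero_of_wsum_add_eq_zero_of_card {K : Type*} [Field K] {d δ q : ℕ} {c : ℕ → K}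
    (hd : 0 < d) {ι Ω : Type*} [Fintype ι] [Field Ω] (φ : K →+* Ω) (α : ι → Ω)
    (hα : ∀ p : MvPolynomial ι K, p ≠ 0 → eval₂ φ α p ≠ 0) (E : Finset ℕ)
    (hE : E.card = Fintype.card ι) (hC : ∀ e ∈ E, c e ≠ 0 → e = d * (q + 1) ∧ d = δ + 1)
    (x : ι → Ω) (hx : ∀ e ∈ E, wsum d δ α x e + φ (c e) * wsum d δ α x q ^ d = 0) : x = 0 := by
  have u := Fintype.equivFin ι
  have hw : ∀ e, wsum d δ (α ∘ u.symm) (x ∘ u.symm) e = wsum d δ α x e := fun e =>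
    Fintype.sum_equiv u.symm _ _ fun _ => rfl
  have h := eq_zero_of_wsum_add_eq_zero hd (Fintype.card ι) φ (α ∘ u.symm) (fun p hp => ?_) E hE hC
    (x ∘ u.symm) (fun e he => by rw [hw, hw]; exact hx e he)
  · funext i
    simpa using congrFun h (u i)
  · rw [← eval₂_rename]
    exact hα _ fun h0 => hp (rename_injective _ u.symm.injective (by rw [h0, map_zero]))

variable {n d D : ℕ} [NeZero n]

theorem iterate_lieD_gtop_X_pow {R : Type*} [CommRing R] (hD : 0 < D)
    (α : {i : Fin n // i ≠ 0} → R) (j : {i : Fin n // i ≠ 0}) {m : ℕ} (hm : 0 < m) (k : ℕ) :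
    (lieD (gtop R n d D α))^[k] (X j.1 ^ m) =
      C (((∏ i ∈ Finset.range k, (m + i * (D - 1)) : ℕ) : R) * α j ^ k) *
        X j.1 ^ (m + k * (D - 1)) := by
  induction k with
  | zero => simp
  | succ k ih =>
    have hpos : m + k * (D - 1) ≠ 0 := by omega
    obtain ⟨s, hs⟩ := Nat.exists_eq_succ_of_ne_zero hpos
    obtain ⟨t, rfl⟩ := Nat.exists_eq_succ_of_ne_zero hD.ne'
    rw [Function.iterate_succ_apply', ih, ← smul_eq_C_mul, Derivation.map_smul,
      Derivation.leibniz_pow]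
    have hX : lieD (gtop R n d (t + 1) α) (X j.1) = C (α j) * X j.1 ^ (t + 1) := by
      rw [lieD, mkDerivation_X, gtop, dif_neg j.2]
    simp only [Nat.succ_eq_add_one, Nat.add_sub_cancel] at hs ⊢
    rw [hX, Finset.prod_range_succ, show m + (k + 1) * t = s + (t + 1) by linarith, hs]
    simp only [smul_eq_C_mul, nsmul_eq_mul, Nat.add_sub_cancel, smul_eq_mul]
    push_cast
    simp only [map_mul, map_pow, map_add, map_prod, map_natCast, map_one]
    ring

theorem iterate_lieD_gtop_X_zero {R : Type*} [CommRing R] (α : {i : Fin n // i ≠ 0} → R) (k : ℕ) :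
    (lieD (gtop R n D D α))^[k] (X 0) = lieSys (gtop R n D D α) (powerSum R n D) k := by
  cases k with
  | zero => rfl
  | succ k =>
    rw [Function.iterate_succ_apply, lieD, mkDerivation_X, gtop, dif_pos rfl, if_pos rfl]
    rfl

theorem eval_lieSys_succ {R : Type*} [CommRing R] (hd : 0 < d) (hD : 0 < D)
    (α : {i : Fin n // i ≠ 0} → R) (x : Fin n → R) (k : ℕ) :
    eval x (lieSys (gtop R n d D α) (powerSum R n d) (k + 1)) =
      eval x ((lieD (gtop R n d D α))^[k] (X 0 ^ d)) +
        ((∏ i ∈ Finset.range k, (d + i * (D - 1)) : ℕ) : R) *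
          wsum d (D - 1) α (fun j => x j.1) k := by
  rw [lieSys, powerSum, iterate_map_add, map_add]
  congr 1
  have h : ∀ s : Finset {i : Fin n // i ≠ 0}, (lieD (gtop R n d D α))^[k] (∑ j ∈ s, X j.1 ^ d) =
      ∑ j ∈ s, (lieD (gtop R n d D α))^[k] (X j.1 ^ d) := fun s => by
    simpa only [Module.End.pow_apply, Derivation.coeFn_coe] using
      map_sum ((lieD (gtop R n d D α)).toLinearMap ^ k) (fun j => X j.1 ^ d) s
  rw [← Finset.sum_subtype_eq_sum_filter, Finset.subtype_univ, h]
  simp_rw [iterate_lieD_gtop_X_pow hD α _ hd k]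
  rw [map_sum, wsum, Finset.mul_sum]
  exact Finset.sum_congr rfl fun j _ => by simp only [map_mul, eval_C, map_pow, eval_X, mul_assoc]

theorem exists_eval_iterate_lieD_gtop_X_zero_pow {Ω : Type*} [Field Ω] (hd : 0 < d)
    (α : {i : Fin n // i ≠ 0} → Ω) (x : Fin n → Ω) {ℓ : ℕ}
    (hx : ∀ i ≤ n, i ≠ ℓ → eval x (lieSys (gtop Ω n d D α) (powerSum Ω n d) i) = 0) :
    ∃ c : ℕ, ∀ k ≤ n, 1 ≤ ℓ ∨ 1 ≤ k →
      eval x ((lieD (gtop Ω n d D α))^[k] (X 0 ^ d)) =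
        if k = d * ℓ ∧ d = D then
          c * eval x (lieSys (gtop Ω n d D α) (powerSum Ω n d) ℓ) ^ d
        else 0 := by
  by_cases hdD : d = D
  · subst hdD
    simp_rw [← iterate_lieD_gtop_X_zero] at hx ⊢
    obtain ⟨c, hc⟩ := Derivation.exists_map_iterate_pow_eq _ (eval x) _ hx d
    exact ⟨c, fun k hk _ => by simpa using hc k hk⟩
  · refine ⟨0, fun k hk h1 => ?_⟩
    rw [if_neg fun h => hdD h.2]
    cases k with
    | zero =>
      have h0 := hx 0 (Nat.zero_le n) (by omega)
      rw [lieSys, eval_X] at h0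
      simp [h0, hd.ne']
    | succ k =>
      rw [Function.iterate_succ_apply, Derivation.leibniz_pow, lieD, mkDerivation_X, gtop,
        dif_pos rfl, if_neg hdD, smul_zero, smul_zero, iterate_map_zero, map_zero]

theorem eq_zero_of_forall_eval_lieSys_eq_zero {K : Type*} [Field K] [CharZero K] {Ω : Type*}
    [Field Ω] (hd : 0 < d) (hD : 0 < D) (φ : K →+* Ω) (α : {i : Fin n // i ≠ 0} → Ω)
    (hα : ∀ p : MvPolynomial {i : Fin n // i ≠ 0} K, p ≠ 0 → eval₂ φ α p ≠ 0) (x : Fin n → Ω)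
    {ℓ : ℕ} (hℓ : ℓ ≤ n)
    (hx : ∀ i ≤ n, i ≠ ℓ → eval x (lieSys (gtop Ω n d D α) (powerSum Ω n d) i) = 0) : x = 0 := by
  have hΩ : CharZero Ω := charZero_of_injective_ringHom φ.injective
  have hn : 0 < n := Nat.pos_of_ne_zero (NeZero.ne n)
  have hcard : Fintype.card {i : Fin n // i ≠ 0} = n - 1 := by simp
  obtain ⟨c, hc⟩ := exists_eval_iterate_lieD_gtop_X_zero_pow hd α x hx
  have hne : ∀ k : ℕ, ((∏ i ∈ Finset.range k, (d + i * (D - 1)) : ℕ) : Ω) ≠ 0 := fun k => by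
    rw [Nat.cast_ne_zero, Finset.prod_ne_zero_iff]
    intro i _
    omega
  have heq := eval_lieSys_succ (n := n) hd hD α x
  have hrest : (fun j : {i : Fin n // i ≠ 0} => x j.1) = 0 := by
    rcases ℓ with _ | q
    · refine eq_zero_of_wsum_add_eq_zero_of_card (δ := D - 1) (q := 0) (c := 0) hd φ α hα
        (Finset.Ico 1 n) (by simp) (by simp) _ fun e he => ?_
      rw [Finset.mem_Ico] at he
      have h1 := heq e
      rw [hx _ (by omega) (by omega), hc e (by omega) (Or.inr he.1), if_neg (by omega),
        zero_add] at h1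
      simpa using (mul_eq_zero.1 h1.symm).resolve_left (hne e)
    · have h2 := heq q
      rw [hc q (by omega) (Or.inl (by omega)), if_neg (by
        rintro ⟨h, -⟩
        have := Nat.le_mul_of_pos_left (q + 1) hd
        omega), zero_add] at h2
      refine eq_zero_of_wsum_add_eq_zero_of_card (δ := D - 1) (q := q)
        (c := fun k => if k = d * (q + 1) ∧ d = D then
          (c : K) * ((∏ i ∈ Finset.range q, (d + i * (D - 1)) : ℕ) : K) ^ d /
            ((∏ i ∈ Finset.range k, (d + i * (D - 1)) : ℕ) : K) else 0) hd φ α hα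
        ((Finset.range n).erase q) ?_ ?_ _ fun e he => ?_
      · rw [Finset.card_erase_of_mem (Finset.mem_range.2 (by omega)), hcard, Finset.card_range]
      · intro e _ h
        have := (ite_ne_right_iff.1 h).1
        omega
      · rw [Finset.mem_erase, Finset.mem_range] at he
        have h1 := heq e
        rw [hx _ (by omega) (by omega), hc e (by omega) (Or.inl (by omega)), h2] at h1
        have he0 := hne e
        split_ifs at h1 ⊢ with h
        · rw [map_div₀, map_mul, map_pow, map_natCast, map_natCast, map_natCast]
          field_simp
          linear_combination -h1
        · rw [map_zero, zero_mul, add_zero]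
          rw [zero_add] at h1
          exact (mul_eq_zero.1 h1.symm).resolve_left he0
  funext i
  by_cases hi : i = 0
  · subst hi
    rcases Nat.eq_zero_or_pos ℓ with rfl | h
    · have h1 := heq 0
      rw [hx 1 hn one_ne_zero, hrest] at h1
      simpa [wsum, hd.ne'] using h1.symm
    · simpa [lieSys] using hx 0 (Nat.zero_le n) h.ne
  · exact congrFun hrest ⟨i, hi⟩

end Vanishing

section Generic

variable {K : Type*} [Field K] [CharZero K] {n d D : ℕ} [NeZero n]

theorem exists_C_mul_X_pow_mem_span (hd : 0 < d) (hD : 0 < D) (ℓ : Fin (n + 1)) (j : Fin n) :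
    ∃ P : MvPolynomial {i : Fin n // i ≠ 0} K, P ≠ 0 ∧ ∃ M : ℕ, C P * X j ^ M ∈
      Ideal.span (Set.range fun i : {i : Fin (n + 1) // i ≠ ℓ} =>
        lieSys (gtop (MvPolynomial {i : Fin n // i ≠ 0} K) n d D X) (powerSum _ n d) i.1) := by
  by_contra! hcon
  set A := MvPolynomial {i : Fin n // i ≠ 0} K
  set I := Ideal.span (Set.range fun i : {i : Fin (n + 1) // i ≠ ℓ} =>
    lieSys (gtop A n d D X) (powerSum _ n d) i.1)
  have hdisj : Disjoint (I : Set (MvPolynomial (Fin n) A))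
      ((nonZeroDivisors A).map C ⊔ Submonoid.powers (X j) :
        Submonoid (MvPolynomial (Fin n) A)) := by
    rw [Set.disjoint_right]
    intro p hp hpI
    obtain ⟨_, ⟨P, hP, rfl⟩, _, ⟨M, rfl⟩, rfl⟩ := Submonoid.mem_sup.1 hp
    exact hcon P (nonZeroDivisors.ne_zero hP) M hpI
  obtain ⟨𝔭, hprime, hle, hdis⟩ := Ideal.exists_le_prime_disjoint I _ hdisj
  rw [Set.disjoint_right] at hdis
  let Ω := FractionRing (MvPolynomial (Fin n) A ⧸ 𝔭)
  let ψ : MvPolynomial (Fin n) A →+* Ω := (algebraMap _ Ω).comp (Ideal.Quotient.mk 𝔭)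
  have hψ : ∀ p, ψ p = 0 ↔ p ∈ 𝔭 := fun p => by
    rw [RingHom.comp_apply, FaithfulSMul.algebraMap_eq_zero_iff, Ideal.Quotient.eq_zero_iff_mem]
  clear_value ψ
  have hx := eq_zero_of_forall_eval_lieSys_eq_zero hd hD ((ψ.comp C).comp (C : K →+* A))
    (fun i => ψ (C (X i))) (fun P hP h => ?_) (fun i => ψ (X i)) (Nat.lt_succ_iff.1 ℓ.2) ?_
  · refine hdis (a := X j) (Submonoid.mem_sup_right (Submonoid.mem_powers _)) ?_
    exact (hψ _).1 (congrFun hx j)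
  · refine hdis (a := C P) (Submonoid.mem_sup_left ⟨P, mem_nonZeroDivisors_of_ne_zero hP, rfl⟩) ?_
    rw [SetLike.mem_coe, ← hψ, ← h]
    change (ψ.comp C) P = _
    conv_lhs => rw [← eval₂_eta P, hom_eval₂]
    rfl
  · intro i hi hne
    have hmem : lieSys (gtop A n d D X) (powerSum _ n d) i ∈ 𝔭 :=
      hle (Ideal.subset_span ⟨⟨⟨i, by omega⟩, fun h => hne (by rw [← h])⟩, rfl⟩)
    have hmap := map_lieSys (d := d) (D := D) (ψ.comp C) (X : {i : Fin n // i ≠ 0} → A) i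
    simp only [RingHom.comp_apply] at hmap
    rw [← (hψ _).2 hmem, ← hmap, eval_map]
    conv_rhs => rw [← eval₂_eta (lieSys _ _ _), hom_eval₂]

theorem exists_forall_eval_ne_zero_X_pow_mem_span (hd : 0 < d) (hD : 0 < D) :
    ∃ P : MvPolynomial {i : Fin n // i ≠ 0} K, P ≠ 0 ∧
      ∀ α : {i : Fin n // i ≠ 0} → K, eval α P ≠ 0 → ∀ ℓ : Fin (n + 1), ∃ M : ℕ, ∀ j : Fin n,
        X j ^ M ∈ Ideal.span (Set.range fun i : {i : Fin (n + 1) // i ≠ ℓ} =>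
          lieSys (gtop K n d D α) (powerSum K n d) i.1) := by
  choose P hP M hM using exists_C_mul_X_pow_mem_span (K := K) (n := n) hd hD
  refine ⟨∏ ℓ, ∏ j, P ℓ j, Finset.prod_ne_zero_iff.2 fun ℓ _ =>
    Finset.prod_ne_zero_iff.2 fun j _ => hP ℓ j, fun α hα ℓ =>
    ⟨Finset.univ.sup (M ℓ), fun j => ?_⟩⟩
  simp only [map_prod, Finset.prod_ne_zero_iff] at hα
  have h := Ideal.mem_map_of_mem (map (eval α)) (hM ℓ j)
  rw [Ideal.map_span, ← Set.range_comp] at h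
  simp only [Function.comp_def, map_lieSys, eval_X, map_mul, map_pow, map_X, map_C] at h
  have h2 := Ideal.mul_mem_left _ (C (eval α (P ℓ j))⁻¹) h
  rw [← mul_assoc, ← C_mul, inv_mul_cancel₀ (hα ℓ (Finset.mem_univ _) j (Finset.mem_univ _)),
    C_1, one_mul] at h2
  exact Ideal.pow_mem_of_pow_mem _ h2 (Finset.le_sup (Finset.mem_univ j))

end Generic

section Elimination

variable {K Ω : Type*} [CommRing K] [CommRing Ω] {n : ℕ} [NeZero n] (d D : ℕ)

theorem setOf_eval₂_pSys_eq_zero (ρ : K →+* Ω) (α : {i : Fin n // i ≠ 0} → K) (ℓ : Fin (n + 1))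
    (Y : {i : Fin (n + 1) // i ≠ ℓ} → Ω) :
    {v : (Unit ⊕ {i : Fin n // i ≠ 0}) → Ω | ∀ j : Fin n,
      eval₂ ρ (Sum.elim (fun i : Fin (n + 1) => if h : i = ℓ then v (Sum.inl ()) else Y ⟨i, h⟩)
        (fun i : {i : Fin n // i ≠ 0} => v (Sum.inr i))) (pSys K n d D α j) = 0} =
    (fun x : Fin n → Ω => Sum.elim
      (fun _ : Unit => eval₂ ρ x (lieSys (gsys K n d D α) (gsys K n d D α 0) ℓ))
      (fun i : {i : Fin n // i ≠ 0} => x i.1)) ''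
    {x | ∀ i : {i : Fin (n + 1) // i ≠ ℓ},
      eval₂ ρ x (lieSys (gsys K n d D α) (gsys K n d D α 0) i.1) = Y i} := by
  set f := lieSys (gsys K n d D α) (gsys K n d D α 0) with hf
  set u : ((Unit ⊕ {i : Fin n // i ≠ 0}) → Ω) → Fin (n + 1) → Ω := fun v i =>
    if h : i = ℓ then v (Sum.inl ()) else Y ⟨i, h⟩ with hu
  set t : ((Unit ⊕ {i : Fin n // i ≠ 0}) → Ω) → Fin n → Ω := fun v i =>
    if h : i = 0 then u v 0 else v (Sum.inr ⟨i, h⟩) with ht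
  have hp : ∀ v j, eval₂ ρ (Sum.elim (u v) fun i => v (Sum.inr i)) (pSys K n d D α j) =
      u v j.succ - eval₂ ρ (t v) (f (j.succ : Fin (n + 1))) := fun v j => by
    rw [pSys, eval₂_sub, eval₂_X, eval₂_rename, Sum.elim_inl, hf, Fin.val_succ, lieSys]
    congr 2
    funext i
    simp only [ht, Function.comp_apply]
    split_ifs <;> rfl
  have hiff : ∀ v, (∀ j : Fin n, eval₂ ρ (Sum.elim (u v) fun i => v (Sum.inr i))
      (pSys K n d D α j) = 0) ↔ ∀ i : Fin (n + 1), eval₂ ρ (t v) (f i) = u v i := fun v => by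
    simp only [hp, sub_eq_zero, eq_comm (a := u v _)]
    refine ⟨fun h i => ?_, fun h j => h j.succ⟩
    refine Fin.cases ?_ h i
    simp [hf, lieSys, ht]
  ext v
  simp only [Set.mem_ofPred_eq, Set.mem_image]
  rw [hiff]
  constructor
  · intro h
    refine ⟨t v, fun i => (h i.1).trans (dif_neg i.2), funext ?_⟩
    rintro (⟨⟩ | i)
    · exact (h ℓ).trans (dif_pos rfl)
    · exact dif_neg i.2
  · rintro ⟨x, hx, rfl⟩ i
    set v : (Unit ⊕ {i : Fin n // i ≠ 0}) → Ω :=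
      Sum.elim (fun _ : Unit => eval₂ ρ x (f ℓ)) fun i => x i.1
    have huv : ∀ i, u v i = eval₂ ρ x (f i) := fun i => by
      by_cases h : i = ℓ
      · subst h
        exact dif_pos rfl
      · exact (dif_neg h).trans (hx ⟨i, h⟩).symm
    have htv : t v = x := funext fun i => by
      by_cases h : i = 0
      · subst h
        refine (dif_pos rfl).trans ((huv 0).trans ?_)
        simp [hf, lieSys]
      · exact dif_neg h
    rw [htv, huv]

theorem injOn_sumElim_eval₂_lieSys (ρ : K →+* Ω) (g : Fin n → MvPolynomial (Fin n) K)
    (p : MvPolynomial (Fin n) K) (ℓ : Fin (n + 1)) (Y : {i : Fin (n + 1) // i ≠ ℓ} → Ω) :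
    Set.InjOn (fun x : Fin n → Ω => Sum.elim (fun _ : Unit => eval₂ ρ x (lieSys g p ℓ))
      (fun i : {i : Fin n // i ≠ 0} => x i.1))
    {x | ∀ i : {i : Fin (n + 1) // i ≠ ℓ}, eval₂ ρ x (lieSys g p i.1) = Y i} := by
  intro x hx y hy hxy
  funext i
  by_cases hi : i = 0
  · subst hi
    by_cases hℓ : ℓ = 0
    · subst hℓ
      simpa [lieSys] using congrFun hxy (Sum.inl ())
    · have h := (hx ⟨0, Ne.symm hℓ⟩).trans (hy ⟨0, Ne.symm hℓ⟩).symm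
      simpa [lieSys] using h
  · exact congrFun hxy (Sum.inr ⟨i, hi⟩)

end Elimination

theorem prod_lieWeight {n : ℕ} (d D : ℕ) (hd : 0 < d) (ℓ : Fin (n + 1)) :
    ∏ i : {i : Fin (n + 1) // i ≠ ℓ}, lieWeight d D i.1 =
      if (ℓ : ℕ) = 0 then ∏ k ∈ Finset.Icc 1 n, (d + (k - 1) * (D - 1))
      else (∏ k ∈ Finset.Icc 1 n, (d + (k - 1) * (D - 1))) / (d + ((ℓ : ℕ) - 1) * (D - 1)) := by
  have hpos : 0 < lieWeight d D ℓ := by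
    cases h : (ℓ : ℕ) with
    | zero => exact one_pos
    | succ k => exact Nat.add_pos_left hd _
  have htot : ∏ i : Fin (n + 1), lieWeight d D i =
      ∏ k ∈ Finset.Icc 1 n, (d + (k - 1) * (D - 1)) := by
    rw [Fin.prod_univ_succ, Fin.val_zero, lieWeight, one_mul,
      ← Finset.Ico_succ_right_eq_Icc, Finset.prod_Ico_eq_prod_range]
    simp only [Fin.val_succ, lieWeight, Nat.add_sub_cancel_left]
    exact Fin.prod_univ_eq_prod_range (fun k => d + k * (D - 1)) n
  have hsplit : (∏ i : {i : Fin (n + 1) // i ≠ ℓ}, lieWeight d D i.1) * lieWeight d D ℓ =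
      ∏ i : Fin (n + 1), lieWeight d D i := by
    rw [Fintype.prod_eq_mul_prod_compl ℓ, mul_comm]
    congr 1
    exact (Finset.prod_subtype {ℓ}ᶜ (by simp) fun i : Fin (n + 1) => lieWeight d D i).symm
  rw [htot] at hsplit
  split_ifs with h
  · rw [h] at hsplit
    rw [← hsplit, lieWeight, mul_one]
  · obtain ⟨k, hk⟩ := Nat.exists_eq_succ_of_ne_zero h
    rw [← hsplit]
    rw [hk] at hpos ⊢
    exact (Nat.mul_div_cancel _ hpos).symm

theorem statement16 (K : Type*) [Field K] [CharZero K] (n d D : ℕ) [NeZero n]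
    (hd : 0 < d) (hD : 0 < D) (hdD : d ≤ D) :
    ∃ P : MvPolynomial {i : Fin n // i ≠ 0} K, P ≠ 0 ∧
      ∀ α : {i : Fin n // i ≠ 0} → K, MvPolynomial.eval α P ≠ 0 →
        ∀ ℓ : Fin (n + 1),
          {v : (Unit ⊕ {i : Fin n // i ≠ 0}) → AlgebraicClosure (Ffield K n ℓ) |
            ∀ j : Fin n,
              eval₂
                ((algebraMap (Ffield K n ℓ) (AlgebraicClosure (Ffield K n ℓ))).comp
                  ((algebraMap (MvPolynomial {i : Fin (n + 1) // i ≠ ℓ} K)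
                      (Ffield K n ℓ)).comp
                    (C : K →+* MvPolynomial {i : Fin (n + 1) // i ≠ ℓ} K)))
                (Sum.elim
                  (fun i : Fin (n + 1) =>
                    if h : i = ℓ then v (Sum.inl ())
                    else algebraMap (Ffield K n ℓ) (AlgebraicClosure (Ffield K n ℓ))
                      (algebraMap (MvPolynomial {i : Fin (n + 1) // i ≠ ℓ} K)
                        (Ffield K n ℓ) (X ⟨i, h⟩)))
                  (fun i : {i : Fin n // i ≠ 0} => v (Sum.inr i)))
                (pSys K n d D α j) = 0}.Finite ∧
          Set.ncard
            {v : (Unit ⊕ {i : Fin n // i ≠ 0}) → AlgebraicClosure (Ffield K n ℓ) |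
              ∀ j : Fin n,
                eval₂
                  ((algebraMap (Ffield K n ℓ) (AlgebraicClosure (Ffield K n ℓ))).comp
                    ((algebraMap (MvPolynomial {i : Fin (n + 1) // i ≠ ℓ} K)
                        (Ffield K n ℓ)).comp
                      (C : K →+* MvPolynomial {i : Fin (n + 1) // i ≠ ℓ} K)))
                  (Sum.elim
                    (fun i : Fin (n + 1) =>
                      if h : i = ℓ then v (Sum.inl ())
                      else algebraMap (Ffield K n ℓ) (AlgebraicClosure (Ffield K n ℓ))
                        (algebraMap (MvPolynomial {i : Fin (n + 1) // i ≠ ℓ} K)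
                          (Ffield K n ℓ) (X ⟨i, h⟩)))
                    (fun i : {i : Fin n // i ≠ 0} => v (Sum.inr i)))
                  (pSys K n d D α j) = 0} =
            (if (ℓ : ℕ) = 0 then ∏ k ∈ Finset.Icc 1 n, (d + (k - 1) * (D - 1))
             else (∏ k ∈ Finset.Icc 1 n, (d + (k - 1) * (D - 1))) /
               (d + ((ℓ : ℕ) - 1) * (D - 1))) := by
  obtain ⟨P, hP, h⟩ := exists_forall_eval_ne_zero_X_pow_mem_span (K := K) (n := n) hd hD
  refine ⟨P, hP, fun α hα ℓ => ?_⟩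
  obtain ⟨M, hM⟩ := h α hα ℓ
  have hbez := finite_and_ncard_aeval_eq_X
    (f := fun i : {i : Fin (n + 1) // i ≠ ℓ} => lieSys (gsys K n d D α) (gsys K n d D α 0) i.1)
    (finSuccAboveEquiv ℓ).symm (fun i => isHomogeneous_lieSys hd hD α i.1)
    (fun i => totalDegree_lieSys_sub_lt hd hD hdD α i.1) hM
  rw [prod_lieWeight d D hd ℓ] at hbez
  rw [setOf_eval₂_pSys_eq_zero d D _ α ℓ fun i =>
    algebraMap (Ffield K n ℓ) (AlgebraicClosure (Ffield K n ℓ))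
      (algebraMap (MvPolynomial {i : Fin (n + 1) // i ≠ ℓ} K) (Ffield K n ℓ) (X i))]
  exact ⟨hbez.1.image _, (injOn_sumElim_eval₂_lieSys _ _ _ ℓ _).ncard_image.trans hbez.2⟩
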